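/- Let k ≥ 1 and let φ : F_n →* N_k be a surjective homomorphism onto the nonorientable genus-k surface group. If φ is irreducible, i.e. for every automorphism α of F_n and every index i one has (φ ∘ α)(x_i) ≠ 1, then n = k. -/

import Mathlib

/-- The single relator `x_0² x_1² ⋯ x_{k-1}²` of the nonorientable genus-`k`
surface group, as an element of the free group on `Fin k`. -/
def nonorientableRelator (k : ℕ) : FreeGroup (Fin k) :=
  ((List.finRange k).map (fun i => (FreeGroup.of i) ^ 2)).prod

/-- The nonorientable genus-`k` surface group. -/
def NonorientableSurfaceGroup (k : ℕ) : Type :=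
  PresentedGroup ({nonorientableRelator k} : Set (FreeGroup (Fin k)))

instance (k : ℕ) : Group (NonorientableSurfaceGroup k) :=
  inferInstanceAs (Group (PresentedGroup _))

/-- The standard epimorphism `ρ_k : F_k →* N_k`, the quotient map of the presentation. -/
def standardRho (k : ℕ) : FreeGroup (Fin k) →* NonorientableSurfaceGroup k :=
  PresentedGroup.mk _

namespace NSurf
open FreeGroup hiding map_mul map_inv map_one IsReduced

/-! ### Part 1: Nielsen reduction -/
section Nielsen
variable {k : ℕ}

/-- digits -/
def dig (x : Fin k × Bool) : ℕ := 2 * x.1.val + (if x.2 then 2 else 1)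

lemma dig_pos (x : Fin k × Bool) : 1 ≤ dig x := by
  unfold dig; split_ifs <;> omega

lemma dig_lt (x : Fin k × Bool) : dig x < 2 * k + 1 := by
  have := x.1.isLt
  unfold dig; split_ifs <;> omega

lemma dig_inj {x y : Fin k × Bool} (h : dig x = dig y) : x = y := by
  obtain ⟨a, b⟩ := x
  obtain ⟨c, d⟩ := y
  unfold dig at h
  cases b <;> cases d <;> simp at h ⊢ <;> omega

/-- shortlex code -/
def code : List (Fin k × Bool) → ℕ
  | [] => 0
  | a :: l => dig a * (2 * k + 1) ^ l.length + code l

lemma code_append (x y : List (Fin k × Bool)) :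
    code (x ++ y) = code x * (2 * k + 1) ^ y.length + code y := by
  induction x with
  | nil => simp [code]
  | cons a l ih => simp only [List.cons_append, code, ih, List.length_append, pow_add]; ring

lemma code_lt (l : List (Fin k × Bool)) : code l < (2 * k + 1) ^ l.length := by
  induction l with
  | nil => simp [code]
  | cons a l ih =>
    have := dig_lt a
    simp only [code, List.length_cons, pow_succ']
    calc _ < dig a * (2 * k + 1) ^ l.length + (2 * k + 1) ^ l.length := by omega
      _ = (dig a + 1) * (2 * k + 1) ^ l.length := by ring
      _ ≤ _ := Nat.mul_le_mul_right _ (by omega)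

lemma code_lt_of_length {l m : List (Fin k × Bool)} (h : l.length < m.length) :
    code l < code m := by
  cases m with
  | nil => simp at h
  | cons a m =>
    simp only [List.length_cons] at h
    calc code l < (2 * k + 1) ^ l.length := code_lt l
      _ ≤ (2 * k + 1) ^ m.length := Nat.pow_le_pow_right (by omega) (by omega)
      _ ≤ dig a * (2 * k + 1) ^ m.length := Nat.le_mul_of_pos_left _ (dig_pos a)
      _ ≤ code (a :: m) := by simp [code]

lemma code_inj : ∀ {l m : List (Fin k × Bool)}, code l = code m → l = m := by
  intro l
  induction l with
  | nil =>
    intro m h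
    cases m with
    | nil => rfl
    | cons a m =>
      have := code_lt_of_length (l := ([] : List (Fin k × Bool))) (m := a :: m) (by simp)
      omega
  | cons a l ih =>
    intro m h
    cases m with
    | nil =>
      have := code_lt_of_length (l := ([] : List (Fin k × Bool))) (m := a :: l) (by simp)
      omega
    | cons b m =>
      have hl : l.length = m.length := by
        rcases lt_trichotomy l.length m.length with h1 | h1 | h1
        · have := code_lt_of_length (l := a :: l) (m := b :: m) (by simpa using h1); omega
        · exact h1
        · have := code_lt_of_length (l := b :: m) (m := a :: l) (by simpa using h1); omega
      simp only [code, hl] at h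
      have h1 := code_lt l
      have h2 := code_lt m
      rw [hl] at h1
      have hd : dig a = dig b := by
        have e1 : (dig a * (2 * k + 1) ^ m.length + code l) / (2 * k + 1) ^ m.length = dig a := by
          rw [mul_comm, Nat.mul_add_div (by positivity), Nat.div_eq_of_lt h1]; rfl
        have e2 : (dig b * (2 * k + 1) ^ m.length + code m) / (2 * k + 1) ^ m.length = dig b := by
          rw [mul_comm, Nat.mul_add_div (by positivity), Nat.div_eq_of_lt h2]; rfl
        rw [← e1, ← e2, h]
      rw [hd] at h
      have hlm : code l = code m := by omega
      rw [dig_inj hd, ih hlm]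

lemma code_append_lt_iff {x y b : List (Fin k × Bool)} :
    code (x ++ b) < code (y ++ b) ↔ code x < code y := by
  rw [code_append, code_append, Nat.add_lt_add_iff_right, Nat.mul_lt_mul_right (by positivity)]

lemma length_le_of_code_lt {x y : List (Fin k × Bool)} (h : code x < code y) :
    x.length ≤ y.length := by
  by_contra hc
  have := code_lt_of_length (l := y) (m := x) (by omega)
  omega

/-- shortlex weight -/
def wt (g : FreeGroup (Fin k)) : ℕ := code g.toWord

lemma wt_inj {g h : FreeGroup (Fin k)} (e : wt g = wt h) : g = h :=
  toWord_injective (code_inj e)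

lemma wt_one : wt (1 : FreeGroup (Fin k)) = 0 := by simp [wt, code]

lemma cancel_words (L₁ : List (Fin k × Bool)) : ∀ L₂, FreeGroup.IsReduced L₁ → FreeGroup.IsReduced L₂ →
    ∃ p a b, L₁ = p ++ a ∧ L₂ = p ++ b ∧ FreeGroup.IsReduced (invRev a ++ b) := by
  induction L₁ with
  | nil => intro L₂ _ h2; exact ⟨[], [], L₂, rfl, rfl, by simpa using h2⟩
  | cons x l ih =>
    intro L₂ h1 h2
    have hinv : FreeGroup.IsReduced (invRev (x :: l)) := by
      rw [isReduced_iff_reduce_eq, reduce_invRev, h1.reduce_eq]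
    cases L₂ with
    | nil => exact ⟨[], x :: l, [], rfl, rfl, by simpa using hinv⟩
    | cons y m =>
      by_cases hxy : x = y
      · subst hxy
        obtain ⟨p, a, b, e1, e2, e3⟩ := ih m (List.IsChain.tail h1) (List.IsChain.tail h2)
        exact ⟨x :: p, a, b, by simp [e1], by simp [e2], e3⟩
      · refine ⟨[], x :: l, y :: m, rfl, rfl, ?_⟩
        unfold FreeGroup.IsReduced
        rw [List.isChain_append]
        refine ⟨hinv, h2, ?_⟩
        intro z hz w hw
        simp [invRev] at hz hw
        subst hz hw
        intro e
        obtain ⟨x1, x2⟩ := x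
        obtain ⟨y1, y2⟩ := y
        simp at e hxy ⊢
        have := hxy e
        cases x2 <;> cases y2 <;> simp_all

lemma cancel (u g : FreeGroup (Fin k)) : ∃ p a b, u.toWord = p ++ a ∧ g.toWord = p ++ b ∧
    (u⁻¹ * g).toWord = invRev a ++ b := by
  obtain ⟨p, a, b, h1, h2, h3⟩ := cancel_words u.toWord g.toWord isReduced_toWord isReduced_toWord
  refine ⟨p, a, b, h1, h2, ?_⟩
  rw [← h3.reduce_eq, ← toWord_mk]
  congr 1
  rw [← mul_mk, ← inv_mk, ← mk_toWord (x := u), ← mk_toWord (x := g), h1, h2, ← mul_mk, ← mul_mk]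
  group

/-- ping-pong set -/
def PS (u : FreeGroup (Fin k)) : Set (FreeGroup (Fin k)) := {g | wt (u⁻¹ * g) < wt g}

lemma PS_split {u g : FreeGroup (Fin k)} (h : g ∈ PS u) : ∃ p a b, u.toWord = p ++ a ∧
    g.toWord = p ++ b ∧ code (invRev a) < code p := by
  obtain ⟨p, a, b, h1, h2, h3⟩ := cancel u g
  refine ⟨p, a, b, h1, h2, ?_⟩
  have h' : wt (u⁻¹ * g) < wt g := h
  unfold wt at h'
  rw [h3, h2, code_append_lt_iff] at h'
  exact h'

/-- code of first half -/
def hc (u : FreeGroup (Fin k)) : ℕ := code (u.toWord.take (u.toWord.length / 2))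

/-- secondary measure -/
def m2 (u : FreeGroup (Fin k)) : ℕ := hc u + hc u⁻¹

lemma m2_inv (u : FreeGroup (Fin k)) : m2 u⁻¹ = m2 u := by
  unfold m2; rw [inv_inv, add_comm]

/-- Nielsen smaller -/
def NLt (w u : FreeGroup (Fin k)) : Prop := norm w < norm u ∨ (norm w = norm u ∧ m2 w < m2 u)

lemma core {u v : FreeGroup (Fin k)} {p a s : List (Fin k × Bool)} (hu : u.toWord = p ++ s)
    (hv : v.toWord = p ++ a) (hc' : code (invRev a) < code p) :
    NLt (v⁻¹ * u) u ∨ NLt (u⁻¹ * v) v := by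
  have e1 : v⁻¹ * u = mk (invRev a ++ s) := by
    rw [← mul_mk, ← inv_mk, ← mk_toWord (x := u), ← mk_toWord (x := v), hu, hv, ← mul_mk, ← mul_mk]
    group
  have e2 : u⁻¹ * v = mk (invRev s ++ a) := by
    rw [← mul_mk, ← inv_mk, ← mk_toWord (x := u), ← mk_toWord (x := v), hu, hv, ← mul_mk, ← mul_mk]
    group
  have nu : norm u = p.length + s.length := by rw [FreeGroup.norm, hu, List.length_append]
  have nv : norm v = p.length + a.length := by rw [FreeGroup.norm, hv, List.length_append]
  have n1 : norm (v⁻¹ * u) ≤ a.length + s.length := by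
    rw [e1]; refine norm_mk_le.trans (by simp)
  have n2 : norm (u⁻¹ * v) ≤ a.length + s.length := by
    rw [e2]; refine norm_mk_le.trans (by simp [add_comm])
  have ha : a.length ≤ p.length := by simpa using length_le_of_code_lt hc'
  by_cases c1 : a.length < p.length
  · left; left; omega
  by_cases c2 : s.length < p.length
  · right; left; omega
  by_cases c3 : norm (v⁻¹ * u) < norm u
  · left; left; exact c3
  left; right
  have c4 : norm (v⁻¹ * u) = norm u := by omega
  refine ⟨c4, ?_⟩
  have tw : (v⁻¹ * u).toWord = invRev a ++ s := by
    rw [e1, toWord_mk]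
    apply (Red.sublist reduce.red).eq_of_length
    rw [← toWord_mk, ← e1]
    change norm (v⁻¹ * u) = _
    simp; omega
  have twi : (v⁻¹ * u)⁻¹.toWord = invRev s ++ a := by
    rw [toWord_inv, tw, invRev_append, invRev_invRev]
  have ui : u⁻¹.toWord = invRev s ++ invRev p := by
    rw [toWord_inv, hu, invRev_append]
  have E : hc (v⁻¹ * u)⁻¹ = hc u⁻¹ := by
    unfold hc
    rw [twi, ui]
    have l1 : (invRev s ++ a).length / 2 ≤ (invRev s).length := by simp; omega
    have l2 : (invRev s ++ invRev p).length / 2 ≤ (invRev s).length := by simp; omega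
    rw [List.take_append_of_le_length l1, List.take_append_of_le_length l2]
    congr 2
    simp; omega
  have E2 : hc (v⁻¹ * u) < hc u := by
    unfold hc
    rw [tw, hu, List.take_append, List.take_append]
    have q1 : List.take ((invRev a ++ s).length / 2) (invRev a) = invRev a :=
      List.take_of_length_le (by simp; omega)
    have q2 : List.take ((p ++ s).length / 2) p = p :=
      List.take_of_length_le (by simp; omega)
    rw [q1, q2]
    have q3 : (invRev a ++ s).length / 2 - (invRev a).length = (p ++ s).length / 2 - p.length := by
      simp; omega
    rw [q3, code_append_lt_iff]
    exact hc'
  unfold m2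
  omega

lemma core_inv {u : FreeGroup (Fin k)} {p a s : List (Fin k × Bool)} (hu : u.toWord = p ++ s)
    (hv : u⁻¹.toWord = p ++ a) (ha : a.length ≤ p.length) : u = 1 := by
  have hlen : s.length = a.length := by
    have := congrArg List.length (toWord_inv u)
    rw [hu, hv] at this
    simp at this; omega
  have h1 : p ++ s = invRev a ++ invRev p := by
    rw [← hu, ← invRev_append, ← hv, toWord_inv, invRev_invRev]
  obtain ⟨t, ht⟩ : ∃ t, p = invRev a ++ t := by
    refine ⟨p.drop a.length, ?_⟩
    have := congrArg (List.take a.length) h1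
    rw [List.take_append_of_le_length ha, List.take_append_of_le_length (by simp),
      List.take_of_length_le (l := invRev a) (by simp)] at this
    rw [← this, List.take_append_drop]
  have h2 : t ++ s = invRev t ++ a := by
    have h3 := h1
    rw [ht, invRev_append, invRev_invRev, List.append_assoc] at h3
    exact List.append_cancel_left h3
  have h3 : t = invRev t ∧ s = a := List.append_inj h2 (by simp)
  have h4 : (mk t : FreeGroup (Fin k)) = (mk t)⁻¹ := by
    rw [inv_mk]; rw [← h3.1]
  have h5 : (mk t : FreeGroup (Fin k)) = 1 := by
    have : (mk t : FreeGroup (Fin k)) ^ 2 = 1 := by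
      rw [pow_two]; nth_rewrite 2 [h4]; exact mul_inv_cancel _
    exact (pow_eq_one_iff_left (two_ne_zero)).1 this
  have : u⁻¹ = 1 := by
    rw [← mk_toWord (x := u⁻¹), hv, ht, ← mul_mk, ← mul_mk, h5, ← inv_mk, mul_one, inv_mul_cancel]
  simpa using this

/-- two initial pieces of the same word: one extends the other -/
lemma split_cases {p b p' b' : List (Fin k × Bool)} (h : p ++ b = p' ++ b') :
    (∃ s, p = p' ++ s) ∨ (∃ s, p' = p ++ s) := by
  rcases List.append_eq_append_iff.1 h with ⟨s, h1, _⟩ | ⟨s, h1, _⟩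
  · right; exact ⟨s, h1⟩
  · left; exact ⟨s, h1⟩

lemma PS_disj {u v g : FreeGroup (Fin k)} (h1 : ¬ NLt (v⁻¹ * u) u) (h2 : ¬ NLt (u⁻¹ * v) v)
    (hg : g ∈ PS u) (hg' : g ∈ PS v) : False := by
  obtain ⟨p, a, b, e1, e2, e3⟩ := PS_split hg
  obtain ⟨p', a', b', e1', e2', e3'⟩ := PS_split hg'
  rcases split_cases (e2.symm.trans e2') with ⟨s, hs⟩ | ⟨s, hs⟩
  · rw [hs, List.append_assoc] at e1
    rcases core e1 e1' e3' with h | h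
    · exact h1 h
    · exact h2 h
  · rw [hs, List.append_assoc] at e1'
    rcases core e1' e1 e3 with h | h
    · exact h2 h
    · exact h1 h

lemma PS_disj_inv {u g : FreeGroup (Fin k)} (h1 : u ≠ 1)
    (hg : g ∈ PS u) (hg' : g ∈ PS u⁻¹) : False := by
  obtain ⟨p, a, b, e1, e2, e3⟩ := PS_split hg
  obtain ⟨p', a', b', e1', e2', e3'⟩ := PS_split hg'
  have l := length_le_of_code_lt e3
  have l' := length_le_of_code_lt e3'
  simp only [invRev_length] at l l'
  rcases split_cases (e2.symm.trans e2') with ⟨s, hs⟩ | ⟨s, hs⟩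
  · rw [hs, List.append_assoc] at e1
    exact h1 (core_inv e1 e1' l')
  · rw [hs, List.append_assoc] at e1'
    refine h1 ?_
    have := core_inv (u := u⁻¹) e1' (by rwa [inv_inv]) l
    simpa using this

variable {n : ℕ}

/-- value of a letter -/
def lv (U : Fin n → FreeGroup (Fin k)) (x : Fin n × Bool) : FreeGroup (Fin k) :=
  bif x.2 then U x.1 else (U x.1)⁻¹

lemma pingpong (U : Fin n → FreeGroup (Fin k)) (h1 : ∀ i, U i ≠ 1)
    (hm : ∀ x y : Fin n × Bool, x.1 ≠ y.1 → ¬ NLt ((lv U y)⁻¹ * lv U x) (lv U x)) :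
    Function.Injective (FreeGroup.lift U) := by
  have lv1 : ∀ x, lv U x ≠ 1 := by
    rintro ⟨i, b⟩; cases b <;> simp [lv, h1]
  have disj : ∀ x y : Fin n × Bool, x ≠ y → ∀ g, g ∈ PS (lv U x) → g ∈ PS (lv U y) → False := by
    intro x y hxy g hx hy
    by_cases h : x.1 = y.1
    · have : lv U y = (lv U x)⁻¹ := by
        obtain ⟨i, b⟩ := x
        obtain ⟨j, c⟩ := y
        cases b <;> cases c <;> simp_all [lv]
      rw [this] at hy
      exact PS_disj_inv (lv1 x) hx hy
    · exact PS_disj (hm x y h) (hm y x (Ne.symm h)) hx hy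
  have key : ∀ (l : List (Fin n × Bool)) (x), FreeGroup.IsReduced (x :: l) →
      ((x :: l).map (lv U)).prod ∈ PS (lv U x) := by
    intro l
    induction l with
    | nil =>
      intro x _
      simp only [PS, List.map_cons, List.map_nil, List.prod_cons, List.prod_nil, mul_one,
        Set.mem_ofPred_eq, inv_mul_cancel, wt_one]
      rcases Nat.eq_zero_or_pos (wt (lv U x)) with h | h
      · exact absurd (wt_inj (h.trans wt_one.symm)) (lv1 x)
      · exact h
    | cons y l ih =>
      intro x hx
      have hy := ih y (List.IsChain.tail hx)
      set g := ((y :: l).map (lv U)).prod with hgd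
      rw [List.map_cons, List.prod_cons, ← hgd]
      have hne : y ≠ (x.1, !x.2) := by
        intro e
        have := (List.isChain_cons_cons.1 hx).1
        rw [e] at this
        simp at this
      have hinv : lv U (x.1, !x.2) = (lv U x)⁻¹ := by
        obtain ⟨i, b⟩ := x
        cases b <;> simp [lv]
      have := fun h => disj _ _ hne g hy h
      rw [hinv] at this
      simp only [PS, Set.mem_ofPred_eq, inv_inv, not_lt, inv_mul_cancel_left] at this ⊢
      have hle : wt g ≤ wt (lv U x * g) := by
        by_contra hcon
        exact this (by omega)
      rcases hle.lt_or_eq with h | h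
      · exact h
      · have := wt_inj h
        exact absurd (by simpa using this) (lv1 x)
  rw [injective_iff_map_eq_one]
  intro y hy
  rw [← mk_toWord (x := y), FreeGroup.lift_mk] at hy
  have hr : FreeGroup.IsReduced y.toWord := isReduced_toWord
  rw [← toWord_eq_nil_iff]
  cases hw : y.toWord with
  | nil => rfl
  | cons x l =>
    exfalso
    rw [hw] at hy hr
    have := key l x hr
    unfold lv at this
    rw [hy] at this
    simp only [PS, Set.mem_ofPred_eq, wt_one] at this
    omega

/-- elementary Nielsen automorphism `x_i ↦ w x_i` with `w` a letter different from `x_i`. -/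
def nielsenHom (i : Fin n) (w : FreeGroup (Fin n)) : FreeGroup (Fin n) →* FreeGroup (Fin n) :=
  FreeGroup.lift (fun j => if j = i then w * of i else of j)

lemma nielsenHom_letter {i : Fin n} {y : Fin n × Bool} (h : y.1 ≠ i) (w : FreeGroup (Fin n)) :
    nielsenHom i w (lv of y) = lv of y := by
  obtain ⟨j, b⟩ := y
  simp only at h
  cases b <;> simp [nielsenHom, lv, h]

/-- elementary Nielsen automorphism -/
def nielsenAut (i : Fin n) (y : Fin n × Bool) (h : y.1 ≠ i) :
    FreeGroup (Fin n) ≃* FreeGroup (Fin n) :=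
  MonoidHom.toMulEquiv (nielsenHom i (lv of y)) (nielsenHom i (lv of y)⁻¹)
    (by
      ext j
      by_cases hj : j = i
      · subst hj
        have := nielsenHom_letter h (lv of y)⁻¹
        simp only [MonoidHom.comp_apply]
        nth_rewrite 2 [nielsenHom]
        simp only [lift_apply_of, if_true, map_mul, this]
        simp [nielsenHom]
      · simp [nielsenHom, hj])
    (by
      ext j
      by_cases hj : j = i
      · subst hj
        have := nielsenHom_letter h (lv of y)
        simp only [MonoidHom.comp_apply]
        nth_rewrite 2 [nielsenHom]
        simp only [lift_apply_of, if_true, map_mul, map_inv, this]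
        simp [nielsenHom]
      · simp [nielsenHom, hj])

lemma nielsenAut_of (i : Fin n) (y : Fin n × Bool) (h : y.1 ≠ i) (j : Fin n) :
    nielsenAut i y h (of j) = if j = i then lv of y * of i else of j := by
  change nielsenHom i (lv of y) (of j) = _
  simp [nielsenHom]

/-- inversion automorphism -/
def invAut (i : Fin n) : FreeGroup (Fin n) ≃* FreeGroup (Fin n) :=
  MonoidHom.toMulEquiv (FreeGroup.lift (fun j => if j = i then (of i)⁻¹ else of j))
    (FreeGroup.lift (fun j => if j = i then (of i)⁻¹ else of j))
    (by ext j; by_cases hj : j = i <;> simp [hj])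
    (by ext j; by_cases hj : j = i <;> simp [hj])

lemma invAut_of (i j : Fin n) : invAut i (of j) = if j = i then (of i)⁻¹ else of j := by
  simp [invAut]

/-- **Nielsen**: a homomorphism between free groups which never kills a primitive element of a
basis is injective. -/
theorem nielsen (ψ : FreeGroup (Fin n) →* FreeGroup (Fin k))
    (h : ∀ (α : FreeGroup (Fin n) ≃* FreeGroup (Fin n)) (i : Fin n), ψ (α (of i)) ≠ 1) :
    Function.Injective ψ := by
  classical
  let meas : (FreeGroup (Fin n) ≃* FreeGroup (Fin n)) → ℕ × ℕ := fun α =>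
    (∑ i, norm (ψ (α (of i))), ∑ i, m2 (ψ (α (of i))))
  have wf : WellFounded (InvImage (Prod.Lex (· < ·) (· < ·)) meas) :=
    InvImage.wf _ (WellFounded.prod_lex Nat.lt_wfRel.wf Nat.lt_wfRel.wf)
  obtain ⟨α, -, hα⟩ := wf.has_min Set.univ ⟨MulEquiv.refl _, trivial⟩
  have hα : ∀ β, ¬ Prod.Lex (· < ·) (· < ·) (meas β) (meas α) := fun β => hα β trivial
  let U : Fin n → FreeGroup (Fin k) := fun i => ψ (α (of i))
  have hU : ∀ x, lv U x = ψ (α (lv of x)) := by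
    rintro ⟨i, b⟩; cases b <;> simp [lv, U]
  -- replacing the i-th element
  have repl : ∀ (β : FreeGroup (Fin n) ≃* FreeGroup (Fin n)) (i : Fin n),
      (∀ j, j ≠ i → ψ (β (of j)) = U j) → ¬ NLt (ψ (β (of i))) (U i) := by
    intro β i hj hlt
    apply hα β
    have s1 : ∀ f : FreeGroup (Fin k) → ℕ, ∑ j, f (ψ (β (of j))) + f (U i)
        = ∑ j, f (U j) + f (ψ (β (of i))) := by
      intro f
      rw [← Finset.add_sum_erase _ _ (Finset.mem_univ i),
        ← Finset.add_sum_erase (a := i) _ (fun j => f (U j)) (Finset.mem_univ i)]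
      have : ∑ j ∈ Finset.univ.erase i, f (ψ (β (of j))) = ∑ j ∈ Finset.univ.erase i, f (U j) := by
        apply Finset.sum_congr rfl
        intro j hjm
        rw [hj j (Finset.ne_of_mem_erase hjm)]
      rw [this]; ring
    have a1 := s1 norm
    have a2 := s1 m2
    rw [Prod.lex_def]
    rcases hlt with hlt | ⟨he, hlt⟩
    · left
      change ∑ j, norm (ψ (β (of j))) < ∑ j, norm (U j)
      omega
    · right
      change ∑ j, norm (ψ (β (of j))) = ∑ j, norm (U j) ∧ ∑ j, m2 (ψ (β (of j))) < ∑ j, m2 (U j)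
      omega
  have inj := pingpong U (fun i => h α i) (by
    rintro ⟨i, b⟩ y hy hlt
    have hy : y.1 ≠ i := fun e => hy e.symm
    have hyinv : (lv U y)⁻¹ = lv U (y.1, !y.2) := by
      obtain ⟨j, c⟩ := y; cases c <;> simp [lv]
    rw [hyinv] at hlt
    have hy' : (y.1, !y.2).1 ≠ i := hy
    generalize (y.1, !y.2) = z at hlt hy'
    cases b with
    | true =>
      apply repl ((nielsenAut i z hy').trans α) i
      · intro j hj; simp [nielsenAut_of, hj, U]
      · simp only [MulEquiv.trans_apply, nielsenAut_of, if_true, map_mul, ← hU]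
        exact hlt
    | false =>
      apply repl (((invAut i).trans ((nielsenAut i z hy').trans ((invAut i).trans α)))) i
      · intro j hj; simp [nielsenAut_of, invAut_of, hj, U]
      · have e : invAut i (lv of z) = lv of z := by
          obtain ⟨j, c⟩ := z
          simp only at hy'
          cases c <;> simp [lv, invAut_of, hy']
        simp only [MulEquiv.trans_apply, nielsenAut_of, invAut_of, if_true, map_mul, map_inv, e,
          ← hU]
        have e2 : (lv U z * (ψ (α (of i)))⁻¹)⁻¹ = (lv U z * lv U (i, false))⁻¹ := by
          simp [lv, U]
        rw [e2]
        have e3 : NLt (lv U z * lv U (i, false))⁻¹ (lv U (i, false))⁻¹ := by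
          unfold NLt at hlt ⊢
          rwa [norm_inv_eq, norm_inv_eq, m2_inv, m2_inv]
        simpa [lv] using e3)
  have hc : FreeGroup.lift U = ψ.comp α.toMonoidHom := by
    ext i; simp [U]
  intro x y hxy
  have : FreeGroup.lift U (α.symm x) = FreeGroup.lift U (α.symm y) := by
    rw [hc]; simpa using hxy
  simpa using inj this

end Nielsen
end NSurf

namespace NSurf
open FreeGroup hiding map_mul map_inv map_one IsReduced

/-! ### Part 2: graphs, valued paths -/
section Paths
variable {k : ℕ} {V W : Type} {K K' : Type} [Group K] [Group K']

/-- valued paths in a labelled graph -/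
inductive PP (E : Fin k → V → V → Prop) (l : Fin k → V → V → K) : V → K → V → Prop
  | nil (p : V) : PP E l p 1 p
  | fwd {p q s : V} {g : K} {i : Fin k} : PP E l p g q → E i q s → PP E l p (g * l i q s) s
  | bwd {p q s : V} {g : K} {i : Fin k} : PP E l p g q → E i s q → PP E l p (g * (l i s q)⁻¹) s

variable {E : Fin k → V → V → Prop} {l : Fin k → V → V → K}

lemma PP.trans {p q s : V} {g h : K} (h1 : PP E l p g q) (h2 : PP E l q h s) :
    PP E l p (g * h) s := by
  induction h2 with
  | nil => simpa using h1
  | fwd _ he ih => rw [← mul_assoc]; exact ih.fwd he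
  | bwd _ he ih => rw [← mul_assoc]; exact ih.bwd he

lemma PP.edge {i : Fin k} {p q : V} (h : E i p q) : PP E l p (l i p q) q := by
  simpa using (PP.nil (E := E) (l := l) p).fwd h

lemma PP.edge_inv {i : Fin k} {p q : V} (h : E i p q) : PP E l q (l i p q)⁻¹ p := by
  simpa using (PP.nil (E := E) (l := l) q).bwd h

lemma PP.symm {p q : V} {g : K} (h : PP E l p g q) : PP E l q g⁻¹ p := by
  induction h with
  | nil => simpa using PP.nil _
  | fwd _ he ih => rw [mul_inv_rev]; exact (PP.edge_inv he).trans ih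
  | bwd _ he ih => rw [mul_inv_rev, inv_inv]; exact (PP.edge he).trans ih

lemma PP.bind {E' : Fin k → W → W → Prop} {l' : Fin k → W → W → K'} (f : V → W) (θ : K →* K')
    (h : ∀ i p q, E i p q → PP E' l' (f p) (θ (l i p q)) (f q)) {p q : V} {g : K}
    (hp : PP E l p g q) : PP E' l' (f p) (θ g) (f q) := by
  induction hp with
  | nil => simpa using PP.nil _
  | fwd _ he ih => rw [map_mul]; exact ih.trans (h _ _ _ he)
  | bwd _ he ih => rw [map_mul, map_inv]; exact ih.trans (h _ _ _ he).symm

lemma PP.mono {E' : Fin k → V → V → Prop} (h : ∀ i p q, E i p q → E' i p q) {p q : V} {g : K}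
    (hp : PP E l p g q) : PP E' l p g q :=
  PP.bind id (MonoidHom.id K) (fun _ _ _ he => PP.edge (h _ _ _ he)) hp

/-- pair of labels -/
def prl (l : Fin k → V → V → K) (l' : Fin k → V → V → K') : Fin k → V → V → K × K' :=
  fun i p q => (l i p q, l' i p q)

lemma PP.pair (l' : Fin k → V → V → K') {p q : V} {g : K} (hp : PP E l p g q) :
    ∃ ν, PP E (prl l l') p (g, ν) q := by
  induction hp with
  | nil => exact ⟨1, PP.nil _⟩
  | fwd _ he ih => obtain ⟨ν, h⟩ := ih; exact ⟨_, h.fwd he⟩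
  | bwd _ he ih => obtain ⟨ν, h⟩ := ih; exact ⟨_, h.bwd he⟩

lemma PP.fst {l' : Fin k → V → V → K'} {p q : V} {g : K} {ν : K'}
    (hp : PP E (prl l l') p (g, ν) q) : PP E l p g q :=
  PP.bind (l' := l) id (MonoidHom.fst K K') (fun _ _ _ he => PP.edge he) hp

/-- the tautological label -/
def xl : Fin k → V → V → FreeGroup (Fin k) := fun i _ _ => of i

/-- immersed graphs -/
def Imm (E : Fin k → V → V → Prop) : Prop :=
  (∀ i p q q', E i p q → E i p q' → q = q') ∧ (∀ i p p' q, E i p q → E i p' q → p = p')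

lemma exists_perm [Finite V] (h : Imm E) :
    ∃ s : Fin k → Equiv.Perm V, ∀ i p q, E i p q → s i p = q := by
  classical
  have : Fintype V := Fintype.ofFinite V
  have key : ∀ i, ∃ s : Equiv.Perm V, ∀ p q, E i p q → s p = q := by
    intro i
    let f : V → V := fun p => if hp : ∃ q, E i p q then hp.choose else p
    have hf : ∀ p q, E i p q → f p = q := by
      intro p q hpq
      have hp : ∃ q, E i p q := ⟨q, hpq⟩
      simp only [f, dif_pos hp]
      exact h.1 i p _ _ hp.choose_spec hpq
    have hinj : Set.InjOn f {p | ∃ q, E i p q} := by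
      rintro p ⟨q, hq⟩ p' ⟨q', hq'⟩ e
      rw [hf _ _ hq, hf _ _ hq'] at e
      subst e
      exact h.2 i _ _ _ hq hq'
    obtain ⟨g, hg⟩ := Set.MapsTo.exists_equiv_extend_of_card_eq (t := Finset.univ)
      (α := V) (β := V) (s := {p | ∃ q, E i p q}) (f := f) (by simp) (fun _ _ => by simp) hinj
    refine ⟨g.trans (Equiv.subtypeUnivEquiv (by simp)), ?_⟩
    intro p q hpq
    simp only [Equiv.trans_apply, Equiv.subtypeUnivEquiv_apply]
    rw [hg p ⟨q, hpq⟩, hf p q hpq]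
  choose s hs using key
  exact ⟨s, hs⟩

lemma PP.unique [Finite V] (h : Imm E) {p p' q : V} {g : FreeGroup (Fin k)} {ν ν' : K}
    (h1 : PP E (prl xl l) p (g, ν) q) (h2 : PP E (prl xl l) p' (g, ν') q) : p = p' ∧ ν = ν' := by
  obtain ⟨s, hs⟩ := exists_perm h
  let T : FreeGroup (Fin k) →* Equiv.Perm (V × K) := FreeGroup.lift fun i =>
    Equiv.prodShear (s i)⁻¹ (fun q => Equiv.mulLeft (l i ((s i)⁻¹ q) q))
  have step : ∀ i p q κ, E i p q → T (of i) (q, κ) = (p, l i p q * κ) := by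
    intro i p q κ he
    have e : (s i).symm q = p := by rw [← hs i p q he]; simp
    simp [T, Equiv.prodShear, e]
  have key : ∀ p q (x : FreeGroup (Fin k) × K), PP E (prl xl l) p x q →
      ∀ κ, T x.1 (q, κ) = (p, x.2 * κ) := by
    intro p q x hx
    induction hx with
    | nil => intro κ; simp
    | fwd _ he ih =>
      intro κ
      simp only [Prod.fst_mul, Prod.snd_mul, map_mul, Equiv.Perm.mul_apply, prl, xl]
      rw [step _ _ _ _ he, ih, mul_assoc]
    | bwd _ he ih =>
      intro κ
      simp only [Prod.fst_mul, Prod.snd_mul, map_mul, Equiv.Perm.mul_apply, prl, xl, Prod.fst_inv,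
        Prod.snd_inv, map_inv]
      rw [mul_assoc, ← ih]
      congr 1
      rw [Equiv.Perm.inv_eq_iff_eq, step _ _ _ _ he, mul_inv_cancel_left]
  have e1 := key _ _ _ h1 1
  have e2 := key _ _ _ h2 1
  rw [e1] at e2
  simpa using e2

end Paths

section Positions
open scoped Fin.NatCast Fin.CommRing
variable {k : ℕ} [NeZero k] {K : Type} [Group K]

/-- next position -/
def nx (π : Fin k × Bool) : Fin k × Bool := if π.2 then (π.1 + 1, false) else (π.1, true)

lemma nx_false (i : Fin k) : nx (i, false) = (i, true) := rfl
lemma nx_true (i : Fin k) : nx (i, true) = (i + 1, false) := rfl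

/-- enumeration of positions -/
def sg (j : ℕ) : Fin k × Bool := nx^[j] (0, false)

lemma sg_succ (j : ℕ) : (sg (j + 1) : Fin k × Bool) = nx (sg j) := by
  unfold sg; rw [Function.iterate_succ_apply']

lemma nx_iter_even (m : ℕ) (π : Fin k × Bool) : nx^[2 * m] π = (π.1 + (m : Fin k), π.2) := by
  induction m with
  | zero => simp
  | succ m ih =>
    rw [show 2 * (m + 1) = (2 * m + 1) + 1 by ring, Function.iterate_succ_apply',
      Function.iterate_succ_apply', ih]
    obtain ⟨i, b⟩ := π
    cases b
    · simp [nx, add_assoc]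
    · simp [nx, add_assoc]

lemma nx_iter_N (π : Fin k × Bool) : nx^[2 * k] π = π := by
  rw [nx_iter_even]; simp

lemma nx_snd (π : Fin k × Bool) : (nx π).2 = !π.2 := by
  obtain ⟨i, b⟩ := π; cases b <;> rfl

lemma nx_iter_ne {m : ℕ} (h0 : 0 < m) (h1 : m < 2 * k) (π : Fin k × Bool) : nx^[m] π ≠ π := by
  obtain ⟨t, ht⟩ := Nat.even_or_odd' m
  rcases ht with rfl | rfl
  · rw [nx_iter_even]
    intro h
    have h2 := congrArg Prod.fst h
    simp only [add_eq_left] at h2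
    rw [Fin.natCast_eq_zero] at h2
    have := Nat.le_of_dvd (by omega) h2
    omega
  · rw [Function.iterate_succ_apply', nx_iter_even]
    intro h
    have h2 := congrArg Prod.snd h
    rw [nx_snd] at h2
    simp at h2

lemma nx_inj : Function.Injective (nx : Fin k × Bool → Fin k × Bool) := by
  have hk : 0 < 2 * k := by have := NeZero.pos k; omega
  intro a b h
  have h2 : nx^[2 * k - 1] (nx a) = nx^[2 * k - 1] (nx b) := by rw [h]
  rw [← Function.iterate_succ_apply, ← Function.iterate_succ_apply,
    show (2 * k - 1).succ = 2 * k by omega, nx_iter_N, nx_iter_N] at h2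
  exact h2

lemma nx_surj (π : Fin k × Bool) : ∃ π', nx π' = π :=
  (Finite.injective_iff_surjective.1 nx_inj) π

lemma nx_ne (π : Fin k × Bool) : nx π ≠ π := by
  intro h
  have := congrArg Prod.snd h
  rw [nx_snd] at this
  simp at this

lemma sg_add (j m : ℕ) : (sg (j + m) : Fin k × Bool) = nx^[m] (sg j) := by
  unfold sg; rw [add_comm, Function.iterate_add_apply]

lemma sg_period (j : ℕ) : (sg (j + 2 * k) : Fin k × Bool) = sg j := by
  rw [sg_add, nx_iter_N]

lemma sg_ne {j m : ℕ} (h0 : 0 < m) (h1 : m < 2 * k) : (sg (j + m) : Fin k × Bool) ≠ sg j := by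
  rw [sg_add]; exact nx_iter_ne h0 h1 _

lemma sg_even (m : ℕ) : (sg (2 * m) : Fin k × Bool) = ((m : Fin k), false) := by
  unfold sg; rw [nx_iter_even]; simp

lemma sg_surj (π : Fin k × Bool) : ∃ j, sg j = π := by
  obtain ⟨i, b⟩ := π
  cases b
  · exact ⟨2 * i.val, by rw [sg_even]; simp⟩
  · exact ⟨2 * i.val + 1, by rw [sg_succ, sg_even]; simp [nx_false]⟩

lemma exists_iter (π π' : Fin k × Bool) : ∃ m, nx^[m] π = π' := by
  obtain ⟨j, rfl⟩ := sg_surj π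
  obtain ⟨j', rfl⟩ := sg_surj π'
  refine ⟨j' + (2 * k - 1) * j, ?_⟩
  have hk := NeZero.pos k
  have e : j + (j' + (2 * k - 1) * j) = j' + j * (2 * k) := by
    obtain ⟨t, ht⟩ : ∃ t, 2 * k = t + 1 := ⟨2 * k - 1, by omega⟩
    rw [ht]; simp; ring
  rw [← sg_add, e]
  induction j with
  | zero => simp
  | succ j _ =>
    generalize j + 1 = t
    clear e
    induction t with
    | zero => simp
    | succ t ih => rw [add_mul, one_mul, ← add_assoc, sg_period, ih]

/-- induction around the cycle -/
lemma cyc_ind {S : Fin k × Bool → Prop} (h : ∀ π, S π → S (nx π)) {π : Fin k × Bool} (h0 : S π)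
    (π' : Fin k × Bool) : S π' := by
  obtain ⟨m, rfl⟩ := exists_iter π π'
  induction m with
  | zero => exact h0
  | succ m ih => rw [Function.iterate_succ_apply']; exact h _ ih

/-- consecutive product -/
def pr (a : ℕ → K) (j : ℕ) : ℕ → K
  | 0 => 1
  | m + 1 => pr a j m * a (j + m)

lemma pr_succ' (a : ℕ → K) (j m : ℕ) : pr a j (m + 1) = a j * pr a (j + 1) m := by
  induction m with
  | zero => simp [pr]
  | succ m ih =>
    rw [pr, ih, pr, mul_assoc]
    congr 3
    ring

lemma pr_congr {a b : ℕ → K} {j m : ℕ} (h : ∀ t < m, a (j + t) = b (j + t)) :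
    pr a j m = pr b j m := by
  induction m with
  | zero => rfl
  | succ m ih => rw [pr, pr, ih (fun t ht => h t (by omega)), h m (by omega)]

lemma pr_map {K' : Type} [Group K'] (θ : K →* K') (a : ℕ → K) (j m : ℕ) :
    θ (pr a j m) = pr (fun t => θ (a t)) j m := by
  induction m with
  | zero => simp [pr]
  | succ m ih => rw [pr, pr, map_mul, ih]

lemma pr_rot {a : ℕ → K} {N : ℕ} (hp : ∀ j, a (j + N) = a j) (j : ℕ) :
    pr a j N = 1 ↔ pr a (j + 1) N = 1 := by
  have h1 : a j * pr a (j + 1) N = pr a j N * a j := by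
    rw [← pr_succ', pr, hp]
  constructor
  · intro h; rw [h] at h1; simpa using h1
  · intro h; rw [h] at h1; simpa using h1

lemma pr_rot_all {a : ℕ → K} {N : ℕ} (hp : ∀ j, a (j + N) = a j) {j : ℕ} (h : pr a j N = 1)
    (j' : ℕ) : pr a j' N = 1 := by
  have key : ∀ j, pr a j N = 1 ↔ pr a 0 N = 1 := by
    intro j
    induction j with
    | zero => rfl
    | succ j ih => rw [← pr_rot hp, ih]
  rw [key] at h ⊢
  exact h

/-- relator based at position `j` -/
def rho (k : ℕ) [NeZero k] (j : ℕ) : FreeGroup (Fin k) :=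
  pr (fun m => of (sg m : Fin k × Bool).1) j (2 * k)

lemma rho_zero_eq : rho k 0 = ((List.finRange k).map (fun i => (FreeGroup.of i) ^ 2)).prod := by
  have key : ∀ m, pr (fun m => (of (sg m : Fin k × Bool).1)) 0 (2 * m)
      = ((List.range m).map (fun i : ℕ => (FreeGroup.of (i : Fin k)) ^ 2)).prod := by
    intro m
    induction m with
    | zero => rfl
    | succ m ih =>
      rw [show 2 * (m + 1) = 2 * m + 1 + 1 by ring, pr, pr, ih, List.range_succ]
      simp only [zero_add, sg_succ, sg_even, nx_false]
      simp [pow_two, mul_assoc]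
  rw [rho, key, ← List.map_coe_finRange_eq_range, List.map_map]
  congr 2
  ext i
  simp

lemma PP_pr {V : Type} {E : Fin k → V → V → Prop} {l : Fin k → V → V → K} (c : ℕ → V) (a : ℕ → K)
    (j m : ℕ) (h : ∀ t < m, PP E l (c (j + t)) (a (j + t)) (c (j + t + 1))) :
    PP E l (c j) (pr a j m) (c (j + m)) := by
  induction m with
  | zero => exact PP.nil _
  | succ m ih => exact (ih (fun t ht => h t (by omega))).trans (h m (by omega))

end Positions
end NSurf

namespace NSurf
open FreeGroup hiding map_mul map_inv map_one IsReduced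

section Elim
variable {k : ℕ} [NeZero k] {V : Type}

/-- relator-closed graphs -/
def RC (E : Fin k → V → V → Prop) : Prop :=
  ∀ (c : Fin k × Bool → V) (π₀ : Fin k × Bool),
    (∀ π, π ≠ π₀ → E π.1 (c π) (c (nx π))) → E π₀.1 (c π₀) (c (nx π₀))

/-- a lift: source and target of the edge at each position -/
abbrev LT (k : ℕ) (V : Type) := (Fin k × Bool → V) × (Fin k × Bool → V)

/-- passing an edge -/
def Pass (D : LT k V) (π : Fin k × Bool) (i : Fin k) (p q : V) : Prop :=
  π.1 = i ∧ D.1 π = p ∧ D.2 π = q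

/-- there is an edge passed exactly once -/
def OncePassed (Q : Set (LT k V)) : Prop :=
  ∃ D ∈ Q, ∃ π : Fin k × Bool, ∀ D' ∈ Q, ∀ π' : Fin k × Bool,
    Pass D' π' π.1 (D.1 π) (D.2 π) → D' = D ∧ π' = π

/-- labels along a lift -/
def lab {K : Type} (l : Fin k → V → V → K) (D : LT k V) (m : ℕ) : K :=
  l (sg m).1 (D.1 (sg m)) (D.2 (sg m))

lemma lab_period {K : Type} (l : Fin k → V → V → K) (D : LT k V) (m : ℕ) :
    lab l D (m + 2 * k) = lab l D m := by
  unfold lab; rw [sg_period]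

theorem elim {G : Type} [Group G] (qq : FreeGroup (Fin k) →* G) (hqq : ∀ j, qq (rho k j) = 1)
    (β β' : V) (N : ℕ) : ∀ (Q : Finset (LT k V)) (E : Fin k → V → V → Prop), Q.card = N →
    (∀ D ∈ Q, ∀ π : Fin k × Bool, E π.1 (D.1 π) (D.2 π)) →
    (∀ D ∈ Q, ∀ π : Fin k × Bool, D.2 π = D.1 (nx π) ∨ (D.2 π = β' ∧ D.1 (nx π) = β)) →
    (∀ Q' : Set (LT k V), Q' ⊆ Q → Q'.Nonempty → OncePassed Q') →
    ∃ (E' : Fin k → V → V → Prop) (l : Fin k → V → V → FreeGroup (Fin k)),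
      (∀ i p q, E' i p q → E i p q) ∧
      (∀ i p q, E' i p q → l i p q = of i) ∧
      (∀ i p q, qq (l i p q) = qq (of i)) ∧
      (∀ D ∈ Q, ∀ j, pr (lab l D) j (2 * k) = 1) ∧
      (∀ (W : Type) (EW : Fin k → W → W → Prop) (f : V → W), f β = f β' →
        (∀ i p q, E' i p q → EW i (f p) (f q)) →
        ∀ i p q, E i p q → PP EW xl (f p) (l i p q) (f q)) ∧
      (∀ (Z : Type) (EZ : Fin k → Z → Z → Prop) (f : V → Z), RC EZ → f β = f β' →
        (∀ i p q, E' i p q → EZ i (f p) (f q)) → ∀ i p q, E i p q → EZ i (f p) (f q)) := by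
  classical
  have hk : 0 < k := NeZero.pos k
  induction N with
  | zero =>
    intro Q E hN _ _ _
    rw [Finset.card_eq_zero] at hN
    subst hN
    refine ⟨E, fun i _ _ => of i, fun _ _ _ h => h, fun _ _ _ _ => rfl, fun _ _ _ => rfl,
      by simp, ?_, ?_⟩
    · intro W EW f _ h i p q he
      exact PP.edge (l := xl) (h i p q he)
    · intro Z EZ f _ _ h; exact h
  | succ N ih =>
    intro Q E hN hE htie honce
    obtain ⟨D₀, hD₀, π₀, huniq⟩ := honce Q subset_rfl (by
      rw [Finset.coe_nonempty, ← Finset.card_pos]; omega)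
    have hD₀ : D₀ ∈ Q := hD₀
    let e : Fin k → V → V → Prop := fun i p q => i = π₀.1 ∧ p = D₀.1 π₀ ∧ q = D₀.2 π₀
    have hother : ∀ D ∈ Q, ∀ π : Fin k × Bool, ¬ (D = D₀ ∧ π = π₀) →
        ¬ e π.1 (D.1 π) (D.2 π) := by
      intro D hD π hne he
      exact hne (huniq D hD π he)
    obtain ⟨E', l₁, hsub, h1, h2, h3, h4, h5⟩ := ih (Q.erase D₀) (fun i p q => E i p q ∧ ¬ e i p q)
      (by rw [Finset.card_erase_of_mem hD₀, hN]; rfl)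
      (by
        intro D hD π
        have hD' := Finset.mem_erase.1 hD
        exact ⟨hE D hD'.2 π, hother D hD'.2 π (fun h => hD'.1 h.1)⟩)
      (fun D hD => htie D (Finset.mem_of_mem_erase hD))
      (fun Q' hQ' => honce Q' (hQ'.trans (by
        intro D hD; exact Finset.mem_of_mem_erase hD)))
    obtain ⟨j₀, hj₀⟩ := sg_surj π₀
    let C := pr (lab l₁ D₀) (j₀ + 1) (2 * k - 1)
    let l : Fin k → V → V → FreeGroup (Fin k) := fun i p q => if e i p q then C⁻¹ else l₁ i p q
    have hle : ∀ i p q, ¬ e i p q → l i p q = l₁ i p q := fun i p q h => if_neg h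
    have hle' : ∀ i p q, e i p q → l i p q = C⁻¹ := fun i p q h => if_pos h
    have hsgne : ∀ t < 2 * k - 1, (sg (j₀ + 1 + t) : Fin k × Bool) ≠ π₀ := by
      intro t ht
      rw [← hj₀, add_assoc]
      exact sg_ne (by omega) (by omega)
    have h2k : 2 * k = (2 * k - 1) + 1 := by omega
    have heπ : e (sg j₀ : Fin k × Bool).1 (D₀.1 (sg j₀)) (D₀.2 (sg j₀)) := by
      rw [hj₀]; exact ⟨rfl, rfl, rfl⟩
    refine ⟨E', l, fun i p q h => (hsub i p q h).1, ?_, ?_, ?_, ?_, ?_⟩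
    · intro i p q h
      rw [hle i p q (hsub i p q h).2]
      exact h1 i p q h
    · intro i p q
      by_cases he : e i p q
      · rw [hle' i p q he, map_inv, pr_map]
        have e1 : pr (fun t => qq (lab l₁ D₀ t)) (j₀ + 1) (2 * k - 1)
            = pr (fun t => qq (of (sg t : Fin k × Bool).1)) (j₀ + 1) (2 * k - 1) := by
          apply pr_congr
          intro t _
          exact h2 _ _ _
        have e2 := hqq j₀
        rw [rho, pr_map, h2k, pr_succ', ← e1] at e2
        have e3 : qq (of (sg j₀ : Fin k × Bool).1) = qq (of i) := by rw [hj₀, he.1]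
        rw [e3] at e2
        exact (eq_inv_of_mul_eq_one_left e2).symm
      · rw [hle i p q he]; exact h2 i p q
    · intro D hD j
      by_cases hDD : D = D₀
      · subst hDD
        refine pr_rot_all (lab_period l D) (j := j₀) ?_ j
        rw [h2k, pr_succ']
        have e1 : pr (lab l D) (j₀ + 1) (2 * k - 1) = C := by
          apply pr_congr
          intro t ht
          exact hle _ _ _ (hother D hD _ (fun h => hsgne t ht h.2))
        rw [e1]
        have e2 : lab l D j₀ = C⁻¹ := hle' _ _ _ heπ
        rw [e2, inv_mul_cancel]
      · have := h3 D (Finset.mem_erase.2 ⟨hDD, hD⟩) j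
        rw [← this]
        apply pr_congr
        intro t _
        exact hle _ _ _ (hother D hD _ (fun h => hDD h.1))
    · intro W EW f hf hW i p q hEe
      by_cases he : e i p q
      · rw [hle' i p q he]
        have hpath := PP_pr (E := EW) (l := xl) (fun t => f (D₀.1 (sg t))) (lab l₁ D₀) (j₀ + 1)
          (2 * k - 1) (by
            intro t ht
            have := h4 W EW f hf hW _ _ _ ⟨hE D₀ hD₀ (sg (j₀ + 1 + t)),
              hother D₀ hD₀ _ (fun h => hsgne t ht h.2)⟩
            have e2 : f (D₀.1 (sg (j₀ + 1 + t + 1))) = f (D₀.2 (sg (j₀ + 1 + t))) := by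
              rw [sg_succ]
              rcases htie D₀ hD₀ (sg (j₀ + 1 + t)) with h | ⟨h, h'⟩
              · rw [h]
              · rw [h, h', hf]
            rw [e2]
            exact this)
        have e1 : f (D₀.1 (sg (j₀ + 1))) = f q := by
          rw [sg_succ, hj₀, he.2.2]
          rcases htie D₀ hD₀ π₀ with h | ⟨h, h'⟩
          · rw [h]
          · rw [h, h', hf]
        have e2 : f (D₀.1 (sg (j₀ + 1 + (2 * k - 1)))) = f p := by
          rw [show j₀ + 1 + (2 * k - 1) = j₀ + 2 * k by omega, sg_period, hj₀, he.2.1]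
        rw [e1, e2] at hpath
        exact hpath.symm
      · rw [hle i p q he]
        exact h4 W EW f hf hW i p q ⟨hEe, he⟩
    · intro Z EZ f hRC hf hZ i p q hEe
      by_cases he : e i p q
      · have hft : ∀ π, f (D₀.2 π) = f (D₀.1 (nx π)) := by
          intro π
          rcases htie D₀ hD₀ π with h | ⟨h, h'⟩
          · rw [h]
          · rw [h, h', hf]
        have := hRC (fun π => f (D₀.1 π)) π₀ (by
          intro π hπ
          have := h5 Z EZ f hRC hf hZ _ _ _ ⟨hE D₀ hD₀ π, hother D₀ hD₀ _ (fun h => hπ h.2)⟩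
          rwa [hft] at this)
        rw [he.1, he.2.1, he.2.2, hft]
        exact this
      · exact h5 Z EZ f hRC hf hZ i p q ⟨hEe, he⟩

end Elim

section Link
open scoped Fin.NatCast Fin.CommRing
variable {k : ℕ} [NeZero k] {V : Type}

/-- closed lifts -/
def Disc (E : Fin k → V → V → Prop) (D : LT k V) : Prop :=
  (∀ π, D.2 π = D.1 (nx π)) ∧ ∀ π : Fin k × Bool, E π.1 (D.1 π) (D.2 π)

/-- almost closed lift -/
def Trouble (E : Fin k → V → V → Prop) (u : LT k V) (π₁ : Fin k × Bool) : Prop :=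
  (∀ π, π ≠ π₁ → u.2 π = u.1 (nx π)) ∧ (∀ π : Fin k × Bool, E π.1 (u.1 π) (u.2 π)) ∧
    u.2 π₁ ≠ u.1 (nx π₁)

lemma disc_unique {E : Fin k → V → V → Prop} (hI : Imm E) {D D' : LT k V} (h : Disc E D)
    (h' : Disc E D') {π : Fin k × Bool} (e : D.1 π = D'.1 π) : D = D' := by
  have step : ∀ π, D.1 π = D'.1 π → D.2 π = D'.2 π := by
    intro π e
    have := h.2 π
    rw [e] at this
    exact hI.1 _ _ _ _ this (h'.2 π)
  have key : ∀ π, D.1 π = D'.1 π :=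
    cyc_ind (S := fun π => D.1 π = D'.1 π) (fun π e => by
      rw [← h.1, ← h'.1, step π e]) e
  ext π
  · exact key π
  · exact step π (key π)

lemma disc_trouble {E : Fin k → V → V → Prop} (hI : Imm E) {D u : LT k V} {π₁ : Fin k × Bool}
    (h : Disc E D) (h' : Trouble E u π₁) {π : Fin k × Bool} (e : D.1 π = u.1 π) : False := by
  have step : ∀ π, D.1 π = u.1 π → D.2 π = u.2 π := by
    intro π e
    have := h.2 π
    rw [e] at this
    exact hI.1 _ _ _ _ this (h'.2.1 π)
  have step' : ∀ π, D.2 π = u.2 π → D.1 π = u.1 π := by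
    intro π e
    have := h.2 π
    rw [e] at this
    exact hI.2 _ _ _ _ this (h'.2.1 π)
  have f1 : ∀ m π, D.1 π = u.1 π → nx^[m] π = π₁ → D.1 π₁ = u.1 π₁ := by
    intro m
    induction m with
    | zero => intro π h hm; rw [← hm]; exact h
    | succ m ih =>
      intro π hp hm
      by_cases c : π = π₁
      · rw [← c]; exact hp
      · refine ih (nx π) ?_ hm
        rw [← h.1, ← h'.1 π c, step π hp]
  have f2 : ∀ m, D.1 (nx^[m] (nx π₁)) = u.1 (nx^[m] (nx π₁)) → D.1 (nx π₁) = u.1 (nx π₁) := by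
    intro m
    induction m with
    | zero => intro h; exact h
    | succ m ih =>
      intro hm
      rw [Function.iterate_succ_apply'] at hm
      by_cases c : nx^[m] (nx π₁) = π₁
      · rwa [c] at hm
      · apply ih
        apply step'
        rw [h.1, h'.1 _ c, hm]
  obtain ⟨m, hm⟩ := exists_iter π π₁
  have a1 := f1 m π e hm
  obtain ⟨m', hm'⟩ := exists_iter (nx π₁) π
  have a2 := f2 m' (by rw [hm']; exact e)
  apply h'.2.2
  rw [← step _ a1, h.1, a2]

theorem link {E : Fin k → V → V → Prop} (hI : Imm E) {v₀ : V}
    (hC : ∀ p, ∃ g, PP E xl v₀ g p) {u : LT k V} {π₁ : Fin k × Bool} (hu : Trouble E u π₁)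
    (Q : Set (LT k V)) (hQ : ∀ D ∈ Q, Disc E D ∨ D = u) (hne : Q.Nonempty) : OncePassed Q := by
  by_contra hcon
  have huniq : ∀ D ∈ Q, ∀ D' ∈ Q, ∀ π, D.1 π = D'.1 π → D = D' := by
    intro D hD D' hD' π e
    rcases hQ D hD with h | h <;> rcases hQ D' hD' with h' | h'
    · exact disc_unique hI h h' e
    · subst h'; exact (disc_trouble hI h hu e).elim
    · subst h; exact (disc_trouble hI h' hu e.symm).elim
    · rw [h, h']
  have hA : ∀ D ∈ Q, ∀ i b, ∃ D' ∈ Q, D'.1 (i, !b) = D.1 (i, b) ∧ D'.2 (i, !b) = D.2 (i, b) := by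
    intro D hD i b
    by_contra h
    push Not at h
    refine hcon ⟨D, hD, (i, b), ?_⟩
    rintro D' hD' ⟨i', b'⟩ ⟨e1, e2, e3⟩
    simp only at e1 e2 e3
    subst e1
    by_cases hb : b' = b
    · subst hb; exact ⟨huniq D' hD' D hD _ e2, rfl⟩
    · have : b' = !b := by cases b <;> cases b' <;> simp_all
      subst this
      exact absurd e3 (h D' hD' e2)
  let Dep : V → Fin k × Bool → Prop := fun p π => ∃ D ∈ Q, D.1 π = p
  let Ar : V → Fin k × Bool → Prop := fun p π => ∃ D ∈ Q, D.2 π = p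
  have dflip : ∀ p i b, Dep p (i, b) → Dep p (i, !b) := by
    rintro p i b ⟨D, hD, e⟩
    obtain ⟨D', hD', e1, -⟩ := hA D hD i b
    exact ⟨D', hD', e1.trans e⟩
  have aflip : ∀ p i b, Ar p (i, b) → Ar p (i, !b) := by
    rintro p i b ⟨D, hD, e⟩
    obtain ⟨D', hD', -, e1⟩ := hA D hD i b
    exact ⟨D', hD', e1.trans e⟩
  by_cases huQ : u ∈ Q
  · have hc : ∀ D ∈ Q, ∀ π, π ≠ π₁ → D.2 π = D.1 (nx π) := by
      intro D hD π hπ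
      rcases hQ D hD with h | h
      · exact h.1 π
      · subst h; exact hu.1 π hπ
    have hca : ∀ p π, π ≠ π₁ → Ar p π → Dep p (nx π) := by
      rintro p π hπ ⟨D, hD, e⟩
      exact ⟨D, hD, by rw [← hc D hD π hπ]; exact e⟩
    have hcd : ∀ p π, π ≠ π₁ → Dep p (nx π) → Ar p π := by
      rintro p π hπ ⟨D, hD, e⟩
      exact ⟨D, hD, by rw [hc D hD π hπ]; exact e⟩
    set β := u.1 (nx π₁) with hβ
    have h0 : Dep β (nx π₁) := ⟨u, huQ, rfl⟩
    have hAr : Ar β π₁ := by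
      by_contra hn
      obtain ⟨i₁, b⟩ := π₁
      cases b with
      | true =>
        rw [nx_true] at h0
        have g1 : ∀ i, Dep β (i, false) → Ar β (i, true) := fun i h =>
          aflip β i false (hcd β (i, false) (by simp) (dflip β i false h))
        have g2 : ∀ m : ℕ, Dep β (i₁ + 1 + (m : Fin k), false) := by
          intro m
          induction m with
          | zero => simpa using h0
          | succ m ih =>
            have a := g1 _ ih
            have := hca β _ (by intro e; rw [e] at a; exact hn a) a
            rw [nx_true] at this
            simpa [add_assoc] using this
        have := g2 (k - 1)
        have e : i₁ + 1 + ((k - 1 : ℕ) : Fin k) = i₁ := by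
          rw [Nat.cast_pred (NeZero.pos k)]; simp
        rw [e] at this
        exact hn (g1 _ this)
      | false =>
        rw [nx_false] at h0
        have g1 : ∀ i, Dep β (i, true) → Ar β (i - 1, false) := fun i h => by
          have a := dflip β i true h
          have : ((i, !true) : Fin k × Bool) = nx (i - 1, true) := by rw [nx_true]; simp
          rw [this] at a
          exact aflip β _ true (hcd β _ (by simp) a)
        have g2 : ∀ m : ℕ, Dep β (i₁ - (m : Fin k), true) := by
          intro m
          induction m with
          | zero => simpa using h0
          | succ m ih =>
            have a := g1 _ ih
            have := hca β _ (by intro e; rw [e] at a; exact hn a) a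
            rw [nx_false] at this
            simpa [sub_sub] using this
        have := g1 _ (g2 (k - 1))
        have e : i₁ - ((k - 1 : ℕ) : Fin k) - 1 = i₁ := by
          rw [Nat.cast_pred (NeZero.pos k)]; simp
        rw [e] at this
        exact hn this
    obtain ⟨D, hD, e⟩ := hAr
    have hDu : D = u := by
      rcases hQ D hD with h | h
      · exact huniq D hD u huQ (nx π₁) (by rw [← h.1, e])
      · exact h
    rw [hDu] at e
    exact hu.2.2 e
  · have hd : ∀ D ∈ Q, Disc E D := by
      intro D hD
      rcases hQ D hD with h | h
      · exact h
      · subst h; exact absurd hD huQ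
    have hca : ∀ p π, Ar p π → Dep p (nx π) := by
      rintro p π ⟨D, hD, e⟩
      exact ⟨D, hD, by rw [← (hd D hD).1]; exact e⟩
    have hcd : ∀ p π, Dep p (nx π) → Ar p π := by
      rintro p π ⟨D, hD, e⟩
      exact ⟨D, hD, by rw [(hd D hD).1]; exact e⟩
    have full : ∀ p π, Dep p π → ∀ π', Dep p π' := by
      intro p π hπ
      refine cyc_ind ?_ hπ
      rintro ⟨i, b⟩ h
      cases b
      · exact dflip p i false h
      · apply hca
        have h1 := dflip p i true h
        exact aflip p i false (hcd p (i, false) h)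
    have prop : ∀ p g q, PP E xl p g q → (∀ π, Dep p π) → ∀ π, Dep q π := by
      intro p g q hp h0
      induction hp with
      | nil => exact h0
      | @fwd q s g i _ he ih =>
        obtain ⟨D, hD, e⟩ := ih (i, false)
        have hE := (hd D hD).2 (i, false)
        rw [e] at hE
        have := hI.1 _ _ _ _ hE he
        exact full s _ (hca s (i, false) ⟨D, hD, this⟩)
      | @bwd q s g i _ he ih =>
        obtain ⟨D, hD, e⟩ := hcd q (i, false) (ih _)
        have hE := (hd D hD).2 (i, false)
        rw [e] at hE
        have := hI.2 _ _ _ _ hE he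
        exact full s (i, false) ⟨D, hD, this⟩
    obtain ⟨D, hD⟩ := hne
    obtain ⟨g, hg⟩ := hC (D.1 π₁)
    obtain ⟨g', hg'⟩ := hC (u.1 π₁)
    obtain ⟨D', hD', e⟩ := prop _ _ _ (hg.symm.trans hg') (full _ π₁ ⟨D, hD, rfl⟩) π₁
    exact disc_trouble hI (hd D' hD') hu e

end Link
end NSurf

namespace NSurf
open FreeGroup hiding map_mul map_inv map_one IsReduced

section Main
variable {k n : ℕ} [NeZero k] {V : Type} {G : Type} [Group G]

/-- every map to a relator-closed graph is constant -/
def CC (E : Fin k → V → V → Prop) : Prop :=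
  ∀ (Z : Type) (_ : Finite Z) (EZ : Fin k → Z → Z → Prop), Imm EZ → RC EZ →
    ∀ f : V → Z, (∀ i p q, E i p q → EZ i (f p) (f q)) → ∀ p q, f p = f q

/-- connected -/
def Conn (E : Fin k → V → V → Prop) (v₀ : V) : Prop := ∀ p, ∃ g, PP E xl v₀ g p

/-- conjugates of relators bounding discs -/
def CS (E : Fin k → V → V → Prop) (v₀ : V) : Set (FreeGroup (Fin k)) :=
  {x | ∃ (D : LT k V) (j : ℕ) (h : FreeGroup (Fin k)), Disc E D ∧ PP E xl v₀ h (D.1 (sg j)) ∧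
    x = h * rho k j * h⁻¹}

/-- the fundamental group is a lift -/
def VGood (qq : FreeGroup (Fin k) →* G) (φ : FreeGroup (Fin n) →* G)
    (E : Fin k → V → V → Prop) (v₀ : V) : Prop :=
  ∃ ψ : FreeGroup (Fin n) →* FreeGroup (Fin k), (∀ y, qq (ψ y) = φ y) ∧
    (∀ y, PP E xl v₀ (ψ y) v₀) ∧ ∀ g, PP E xl v₀ g v₀ → g ∈ ψ.range

/-- the fundamental group is a lift together with disc boundaries -/
def Good (qq : FreeGroup (Fin k) →* G) (φ : FreeGroup (Fin n) →* G)
    (E : Fin k → V → V → Prop) (v₀ : V) : Prop :=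
  ∃ ψ : FreeGroup (Fin n) →* FreeGroup (Fin k), (∀ y, qq (ψ y) = φ y) ∧
    (∀ y, PP E xl v₀ (ψ y) v₀) ∧
    ∀ g, PP E xl v₀ g v₀ → g ∈ Subgroup.closure ((ψ.range : Set (FreeGroup (Fin k))) ∪ CS E v₀)

lemma VGood.good {qq : FreeGroup (Fin k) →* G} {φ : FreeGroup (Fin n) →* G}
    {E : Fin k → V → V → Prop} {v₀ : V} (h : VGood qq φ E v₀) : Good qq φ E v₀ := by
  obtain ⟨ψ, h1, h2, h3⟩ := h
  exact ⟨ψ, h1, h2, fun g hg => Subgroup.subset_closure (Or.inl (h3 g hg))⟩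

/-- there is a surjective lift -/
def Concl (qq : FreeGroup (Fin k) →* G) (φ : FreeGroup (Fin n) →* G) : Prop :=
  ∃ ψ : FreeGroup (Fin n) →* FreeGroup (Fin k), (∀ y, qq (ψ y) = φ y) ∧ Function.Surjective ψ

theorem trouble_step [Finite V] {qq : FreeGroup (Fin k) →* G} (hqq : ∀ j, qq (rho k j) = 1)
    {φ : FreeGroup (Fin n) →* G} {E : Fin k → V → V → Prop} {v₀ : V} (hI : Imm E)
    (hC : Conn E v₀) (hG : Good qq φ E v₀) (hCC : CC E) {u : LT k V} {π₁ : Fin k × Bool}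
    (hu : Trouble E u π₁) :
    ∃ (W : Type) (_ : Finite W) (EW : Fin k → W → W → Prop) (w₀ : W), Nat.card W < Nat.card V ∧
      Imm EW ∧ Conn EW w₀ ∧ VGood qq φ EW w₀ ∧ CC EW := by
  classical
  set β := u.1 (nx π₁) with hβ
  set β' := u.2 π₁ with hβ'
  let QS : Set (LT k V) := {D | Disc E D ∨ D = u}
  have hfin : QS.Finite := Set.toFinite QS
  let Q := hfin.toFinset
  have hmem : ∀ D, D ∈ Q ↔ (Disc E D ∨ D = u) := fun D => hfin.mem_toFinset
  obtain ⟨E', l, hsub, h1, h2, h3, h4, h5⟩ := elim qq hqq β β' Q.card Q E rfl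
    (by
      intro D hD π
      rcases (hmem D).1 hD with h | h
      · exact h.2 π
      · rw [h]; exact hu.2.1 π)
    (by
      intro D hD π
      rcases (hmem D).1 hD with h | h
      · exact Or.inl (h.1 π)
      · rw [h]
        by_cases hπ : π = π₁
        · right; rw [hπ]; exact ⟨rfl, rfl⟩
        · left; exact hu.1 π hπ)
    (fun Q' hQ' hne => link hI hC hu Q' (fun D hD => (hmem D).1 (hQ' hD)) hne)
  let J : Setoid V :=
    { r := fun p p' => ∃ h, PP E (prl xl l) p (h, 1) p'
      iseqv :=
        ⟨fun p => ⟨1, PP.nil p⟩,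
          fun {p p'} ⟨h, hp⟩ => ⟨h⁻¹, by simpa using hp.symm⟩,
          fun {p p' p''} ⟨h, hp⟩ ⟨h', hp'⟩ => ⟨h * h', by simpa using hp.trans hp'⟩⟩ }
  have Jdef : ∀ p p', J.r p p' ↔ ∃ h, PP E (prl xl l) p (h, 1) p' := fun _ _ => Iff.rfl
  let W := Quotient J
  let mkW : V → W := Quotient.mk J
  have mkeq : ∀ p p', mkW p = mkW p' ↔ ∃ h, PP E (prl xl l) p (h, 1) p' := by
    intro p p'; exact Quotient.eq (r := J)
  have mks : Function.Surjective mkW := Quotient.mk_surjective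
  let EW : Fin k → W → W → Prop := fun i a b => ∃ p q, mkW p = a ∧ mkW q = b ∧ E' i p q
  -- value of a lift
  have hval : ∀ D ∈ Q, ∀ j, pr (lab (prl xl l) D) j (2 * k) = (rho k j, 1) := by
    intro D hD j
    apply Prod.ext
    · change MonoidHom.fst _ _ _ = _
      rw [pr_map]; rfl
    · change MonoidHom.snd _ _ _ = _
      rw [pr_map]; exact h3 D hD j
  have hββ' : mkW β = mkW β' := by
    rw [mkeq]
    obtain ⟨j, hj⟩ := sg_surj (nx π₁)
    have hk := NeZero.pos k
    -- go around u
    have hp := PP_pr (E := E) (l := prl xl l) (fun t => u.1 (sg t)) (lab (prl xl l) u) j (2 * k - 1)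
      (by
        intro t ht
        have hne : (sg (j + t) : Fin k × Bool) ≠ π₁ := by
          intro e
          have e2 : (sg (j + t + 1) : Fin k × Bool) = sg j := by rw [sg_succ, e, hj]
          rw [add_assoc] at e2
          exact sg_ne (by omega) (by omega) e2
        have := PP.edge (E := E) (l := prl xl l) (hu.2.1 (sg (j + t)))
        rw [sg_succ, ← hu.1 _ hne]
        exact this)
    have hlast : (sg (j + (2 * k - 1)) : Fin k × Bool) = π₁ := by
      apply nx_inj
      rw [← sg_succ, show j + (2 * k - 1) + 1 = j + 2 * k by omega, sg_period, hj]
    have hp2 := hp.trans (PP.edge (E := E) (l := prl xl l) (hu.2.1 (sg (j + (2 * k - 1)))))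
    have hv : pr (lab (prl xl l) u) j (2 * k - 1) * lab (prl xl l) u (j + (2 * k - 1))
        = (rho k j, 1) := by
      rw [← hval u ((hmem u).2 (Or.inr rfl)) j]
      conv_rhs => rw [show 2 * k = 2 * k - 1 + 1 by omega]
      rfl
    unfold lab at hv hp2
    rw [hv] at hp2
    rw [hlast, hj] at hp2
    exact ⟨_, hp2⟩
  have hEW : ∀ i p q, E' i p q → EW i (mkW p) (mkW q) := fun i p q h => ⟨p, q, rfl, rfl, h⟩
  have h4' := h4 W EW mkW hββ' hEW
  have hproj : ∀ p q h ν, PP E (prl xl l) p (h, ν) q → PP EW xl (mkW p) ν (mkW q) := by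
    intro p q h ν hp
    exact PP.bind (l' := xl) mkW (MonoidHom.snd _ _) (fun i p q he => h4' i p q he) hp
  -- inverse projection
  have hlift : ∀ a g b, PP EW xl a g b → a = mkW v₀ →
      ∃ h p, mkW p = b ∧ PP E (prl xl l) v₀ (h, g) p := by
    intro a g b hp ha
    induction hp with
    | nil => exact ⟨1, v₀, ha.symm, PP.nil _⟩
    | @fwd b s g i _ he ih =>
      obtain ⟨h, p, hpb, hp⟩ := ih
      obtain ⟨p₁, q₁, e1, e2, hE'⟩ := he
      obtain ⟨h', hp'⟩ := (mkeq p p₁).1 (hpb.trans e1.symm)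
      have := (hp.trans hp').fwd (hsub _ _ _ hE')
      refine ⟨h * h' * of i, q₁, e2, ?_⟩
      · have e : (h, g) * (h', 1) * prl xl l i p₁ q₁ = (h * h' * of i, g * of i) := by
          simp [prl, xl, h1 _ _ _ hE']
        rw [e] at this
        exact this
    | @bwd b s g i _ he ih =>
      obtain ⟨h, p, hpb, hp⟩ := ih
      obtain ⟨p₁, q₁, e1, e2, hE'⟩ := he
      obtain ⟨h', hp'⟩ := (mkeq p q₁).1 (hpb.trans e2.symm)
      have := (hp.trans hp').bwd (hsub _ _ _ hE')
      refine ⟨h * h' * (of i)⁻¹, p₁, e1, ?_⟩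
      · have e : (h, g) * (h', 1) * (prl xl l i p₁ q₁)⁻¹ = (h * h' * (of i)⁻¹, g * (of i)⁻¹) := by
          simp [prl, xl, h1 _ _ _ hE']
        rw [e] at this
        exact this
  refine ⟨W, inferInstance, EW, mkW v₀, ?_, ⟨?_, ?_⟩, ?_, ?_, ?_⟩
  · apply lt_of_le_of_ne (Nat.card_le_card_of_surjective mkW mks)
    intro hcard
    have hbij := (Nat.bijective_iff_surjective_and_card mkW).2 ⟨mks, hcard.symm⟩
    exact hu.2.2 (hbij.1 hββ').symm
  · rintro i a b b' ⟨p, q, e1, e2, e3⟩ ⟨p', q', e1', e2', e3'⟩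
    rw [← e2, ← e2', mkeq]
    obtain ⟨h, hp⟩ := (mkeq p p').1 (e1.trans e1'.symm)
    have := ((PP.edge_inv (l := prl xl l) (hsub _ _ _ e3)).trans hp).trans
      (PP.edge (l := prl xl l) (hsub _ _ _ e3'))
    have e : (prl xl l i p q)⁻¹ * (h, 1) * prl xl l i p' q' = ((of i)⁻¹ * h * of i, 1) := by
      simp [prl, xl, h1 _ _ _ e3, h1 _ _ _ e3']
    rw [e] at this
    exact ⟨_, this⟩
  · rintro i a a' b ⟨p, q, e1, e2, e3⟩ ⟨p', q', e1', e2', e3'⟩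
    rw [← e1, ← e1', mkeq]
    obtain ⟨h, hp⟩ := (mkeq q q').1 (e2.trans e2'.symm)
    have := ((PP.edge (l := prl xl l) (hsub _ _ _ e3)).trans hp).trans
      (PP.edge_inv (l := prl xl l) (hsub _ _ _ e3'))
    have e : (prl xl l i p q) * (h, 1) * (prl xl l i p' q')⁻¹ = ((of i) * h * (of i)⁻¹, 1) := by
      simp [prl, xl, h1 _ _ _ e3, h1 _ _ _ e3']
    rw [e] at this
    exact ⟨_, this⟩
  · intro a
    obtain ⟨p, rfl⟩ := mks a
    obtain ⟨g, hg⟩ := hC p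
    obtain ⟨ν, hν⟩ := hg.pair l
    exact ⟨ν, hproj _ _ _ _ hν⟩
  · obtain ⟨ψ, hψ1, hψ2, hψ3⟩ := hG
    have hν : ∀ i, ∃ ν, PP E (prl xl l) v₀ (ψ (of i), ν) v₀ := fun i => (hψ2 (of i)).pair l
    choose ν hν using hν
    let ψ' : FreeGroup (Fin n) →* FreeGroup (Fin k) := FreeGroup.lift ν
    have hψ' : ∀ y, PP E (prl xl l) v₀ (ψ y, ψ' y) v₀ := by
      intro y
      induction y using FreeGroup.induction_on with
      | C1 => rw [map_one, map_one]; exact PP.nil v₀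
      | of x => simpa [ψ'] using hν x
      | inv_of x h => simpa [ψ'] using (hν x).symm
      | mul x y hx hy => simpa using hx.trans hy
    have hqv : ∀ p q h ν, PP E (prl xl l) p (h, ν) q → qq ν = qq h := by
      have : ∀ p q (x : FreeGroup (Fin k) × FreeGroup (Fin k)), PP E (prl xl l) p x q →
          qq x.2 = qq x.1 := by
        intro p q x hx
        induction hx with
        | nil => simp
        | fwd _ he ih => simp [prl, xl, h2, ih]
        | bwd _ he ih => simp [prl, xl, h2, ih]
      intro p q h ν hp
      exact this p q _ hp
    refine ⟨ψ', fun y => (hqv _ _ _ _ (hψ' y)).trans (hψ1 y), fun y => hproj _ _ _ _ (hψ' y), ?_⟩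
    intro g hg
    obtain ⟨h, p, hpb, hp⟩ := hlift _ _ _ hg rfl
    obtain ⟨h', hp'⟩ := (mkeq p v₀).1 hpb
    have hp2 := hp.trans hp'
    have e : (h, g) * (h', 1) = (h * h', g) := by simp
    rw [e] at hp2
    have hcl := hψ3 _ hp2.fst
    generalize h * h' = x at hp2 hcl
    have hex : ∃ y, PP E (prl xl l) v₀ (x, ψ' y) v₀ := by
      clear hp2
      induction hcl using Subgroup.closure_induction with
      | mem x hx =>
        rcases hx with ⟨y, rfl⟩ | ⟨D, j, h, hD, hpD, rfl⟩
        · exact ⟨y, hψ' y⟩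
        · obtain ⟨ν', hν'⟩ := hpD.pair l
          refine ⟨1, ?_⟩
          have hcyc := PP_pr (E := E) (l := prl xl l) (fun t => D.1 (sg t)) (lab (prl xl l) D) j
            (2 * k) (by
              intro t _
              have := PP.edge (E := E) (l := prl xl l) (hD.2 (sg (j + t)))
              rw [hD.1] at this
              rw [sg_succ]
              unfold lab
              rw [hD.1]
              exact this)
          rw [hval D ((hmem D).2 (Or.inl hD))] at hcyc
          simp only [sg_period] at hcyc
          simpa using (hν'.trans hcyc).trans hν'.symm
      | one => exact ⟨1, by rw [map_one]; exact PP.nil v₀⟩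
      | mul x y _ _ hx hy =>
        obtain ⟨a, ha⟩ := hx
        obtain ⟨b, hb⟩ := hy
        exact ⟨a * b, by simpa using ha.trans hb⟩
      | inv x _ hx =>
        obtain ⟨a, ha⟩ := hx
        exact ⟨a⁻¹, by simpa using ha.symm⟩
    obtain ⟨y, hy⟩ := hex
    exact ⟨y, (PP.unique hI hp2 hy).2.symm⟩
  · intro Z hZ EZ hIZ hRZ f hf a b
    obtain ⟨p, rfl⟩ := mks a
    obtain ⟨q, rfl⟩ := mks b
    refine hCC Z hZ EZ hIZ hRZ (fun p => f (mkW p)) ?_ p q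
    exact h5 Z EZ (fun p => f (mkW p)) hRZ (by simp only [hββ'])
      (fun i p q h => hf _ _ _ (hEW i p q h))

/-- adding an edge that closes a relator cycle -/
theorem add_edge {qq : FreeGroup (Fin k) →* G}
    {φ : FreeGroup (Fin n) →* G} {E : Fin k → V → V → Prop} {v₀ : V} (hI : Imm E)
    (hC : Conn E v₀) (hG : Good qq φ E v₀) (hCC : CC E) {c : Fin k × Bool → V} {π₀ : Fin k × Bool}
    (hc : ∀ π, π ≠ π₀ → E π.1 (c π) (c (nx π)))
    (hα : ∀ q, ¬ E π₀.1 (c π₀) q) (hβ : ∀ p, ¬ E π₀.1 p (c (nx π₀))) :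
    ∃ E' : Fin k → V → V → Prop, (∀ i p q, E' i p q ↔ E i p q ∨
      (i = π₀.1 ∧ p = c π₀ ∧ q = c (nx π₀))) ∧ Imm E' ∧ Conn E' v₀ ∧ Good qq φ E' v₀ ∧ CC E' := by
  have hk := NeZero.pos k
  let E' : Fin k → V → V → Prop := fun i p q => E i p q ∨ (i = π₀.1 ∧ p = c π₀ ∧ q = c (nx π₀))
  have hle : ∀ i p q, E i p q → E' i p q := fun _ _ _ h => Or.inl h
  refine ⟨E', fun _ _ _ => Iff.rfl, ⟨?_, ?_⟩, ?_, ?_, ?_⟩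
  · rintro i p q q' (h | ⟨h1, h2, h3⟩) (h' | ⟨h1', h2', h3'⟩)
    · exact hI.1 _ _ _ _ h h'
    · subst h1' h2'; exact absurd h (hα _)
    · subst h1 h2; exact absurd h' (hα _)
    · rw [h3, h3']
  · rintro i p p' q (h | ⟨h1, h2, h3⟩) (h' | ⟨h1', h2', h3'⟩)
    · exact hI.2 _ _ _ _ h h'
    · subst h1' h3'; exact absurd h (hβ _)
    · subst h1 h3; exact absurd h' (hβ _)
    · rw [h2, h2']
  · intro p
    obtain ⟨g, hg⟩ := hC p
    exact ⟨g, hg.mono hle⟩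
  · obtain ⟨ψ, hψ1, hψ2, hψ3⟩ := hG
    refine ⟨ψ, hψ1, fun y => (hψ2 y).mono hle, ?_⟩
    set S := Subgroup.closure ((ψ.range : Set (FreeGroup (Fin k))) ∪ CS E' v₀) with hS
    obtain ⟨j₀, hj₀⟩ := sg_surj π₀
    let C : FreeGroup (Fin k) := pr (fun m => of (sg m : Fin k × Bool).1) (j₀ + 1) (2 * k - 1)
    have hxC : of π₀.1 * C = rho k j₀ := by
      rw [rho, show 2 * k = 2 * k - 1 + 1 by omega, pr_succ', hj₀]
    have hCp : PP E xl (c (nx π₀)) C (c π₀) := by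
      have := PP_pr (E := E) (l := xl) (fun t => c (sg t)) (fun m => of (sg m : Fin k × Bool).1)
        (j₀ + 1) (2 * k - 1) (by
          intro t ht
          have hne : (sg (j₀ + 1 + t) : Fin k × Bool) ≠ π₀ := by
            rw [← hj₀, add_assoc]; exact sg_ne (by omega) (by omega)
          have := PP.edge (l := xl) (hc _ hne)
          rw [sg_succ]
          exact this)
      rw [sg_succ, show j₀ + 1 + (2 * k - 1) = j₀ + 2 * k by omega, sg_period, hj₀] at this
      exact this
    have hdisc : Disc E' (c, fun π => c (nx π)) := by
      refine ⟨fun _ => rfl, fun π => ?_⟩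
      by_cases h : π = π₀
      · right; rw [h]; exact ⟨rfl, rfl, rfl⟩
      · left; exact hc π h
    have hrel : ∀ g', PP E xl v₀ g' (c π₀) → g' * (of π₀.1 * C) * g'⁻¹ ∈ S := by
      intro g' hg'
      rw [hxC]
      refine Subgroup.subset_closure (Or.inr ⟨_, j₀, g', hdisc, ?_, rfl⟩)
      simp only
      rw [hj₀]
      exact hg'.mono hle
    have key : ∀ p g q, PP E' xl p g q → p = v₀ → ∃ g', PP E xl v₀ g' q ∧ g * g'⁻¹ ∈ S := by
      intro p g q hp hpv
      induction hp with
      | nil => exact ⟨1, by rw [hpv]; exact PP.nil _, by simp [S.one_mem]⟩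
      | @fwd q s g i _ he ih =>
        obtain ⟨g', hg', hm⟩ := ih
        rcases he with he | ⟨e1, e2, e3⟩
        · refine ⟨g' * of i, hg'.fwd he, ?_⟩
          have : g * xl i q s * (g' * of i)⁻¹ = g * g'⁻¹ := by simp [xl]
          rw [this]; exact hm
        · subst e1 e2 e3
          refine ⟨g' * C⁻¹, hg'.trans hCp.symm, ?_⟩
          have : g * xl π₀.1 (c π₀) (c (nx π₀)) * (g' * C⁻¹)⁻¹
              = (g * g'⁻¹) * (g' * (of π₀.1 * C) * g'⁻¹) := by simp only [xl]; group
          rw [this]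
          exact S.mul_mem hm (hrel g' hg')
      | @bwd q s g i _ he ih =>
        obtain ⟨g', hg', hm⟩ := ih
        rcases he with he | ⟨e1, e2, e3⟩
        · refine ⟨g' * (of i)⁻¹, hg'.bwd he, ?_⟩
          have : g * (xl i s q)⁻¹ * (g' * (of i)⁻¹)⁻¹ = g * g'⁻¹ := by simp [xl]
          rw [this]; exact hm
        · subst e1 e2 e3
          have hg2 := hg'.trans hCp
          refine ⟨g' * C, hg2, ?_⟩
          have : g * (xl π₀.1 (c π₀) (c (nx π₀)))⁻¹ * (g' * C)⁻¹
              = (g * g'⁻¹) * ((g' * C) * (of π₀.1 * C) * (g' * C)⁻¹)⁻¹ := by simp only [xl]; group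
          rw [this]
          exact S.mul_mem hm (S.inv_mem (hrel _ hg2))
    intro g hg
    obtain ⟨g', hg', hm⟩ := key _ _ _ hg rfl
    have h2 : g' ∈ S := by
      refine Subgroup.closure_mono ?_ (hψ3 g' hg')
      refine Set.union_subset_union_right _ ?_
      rintro x ⟨D, j, h, hD, hp, rfl⟩
      exact ⟨D, j, h, ⟨hD.1, fun π => hle _ _ _ (hD.2 π)⟩, hp.mono hle, rfl⟩
    have := S.mul_mem hm h2
    simpa using this
  · intro Z hZ EZ h1 h2 f hf
    exact hCC Z hZ EZ h1 h2 f (fun i p q h => hf i p q (hle i p q h))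

/-- number of missing edges -/
noncomputable def missing (E : Fin k → V → V → Prop) : ℕ :=
  Nat.card {e : Fin k × V × V // ¬ E e.1 e.2.1 e.2.2}

theorem inner [Finite V] {qq : FreeGroup (Fin k) →* G} (hqq : ∀ j, qq (rho k j) = 1)
    {φ : FreeGroup (Fin n) →* G} (v₀ : V) (hV : 1 < Nat.card V)
    (IH : ∀ (W : Type) (_ : Finite W) (EW : Fin k → W → W → Prop) (w₀ : W),
      Nat.card W < Nat.card V → Imm EW → Conn EW w₀ → VGood qq φ EW w₀ → CC EW → Concl qq φ)
    (m : ℕ) : ∀ (E : Fin k → V → V → Prop), missing E = m → Imm E → Conn E v₀ → Good qq φ E v₀ →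
      CC E → Concl qq φ := by
  classical
  induction m using Nat.strong_induction_on with
  | _ m ih =>
  intro E hm hI hC hG hCC
  have htr : ∀ (u : LT k V) (π₁ : Fin k × Bool), Trouble E u π₁ → Concl qq φ := by
    intro u π₁ hu
    obtain ⟨W, hW, EW, w₀, h1, h2, h3, h4, h5⟩ := trouble_step hqq hI hC hG hCC hu
    exact IH W hW EW w₀ h1 h2 h3 h4 h5
  by_cases hRC : RC E
  · exfalso
    have := hCC V inferInstance E hI hRC id (fun _ _ _ h => h)
    have : Subsingleton V := ⟨this⟩
    have := Finite.card_le_one_iff_subsingleton.2 this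
    omega
  · unfold RC at hRC
    push Not at hRC
    obtain ⟨c, π₀, hc, hmiss⟩ := hRC
    by_cases hα : ∃ q, E π₀.1 (c π₀) q
    · obtain ⟨b, hb⟩ := hα
      refine htr (c, fun π => if π = π₀ then b else c (nx π)) π₀ ⟨?_, ?_, ?_⟩
      · intro π hπ; simp [hπ]
      · intro π
        by_cases hπ : π = π₀
        · subst hπ; simpa using hb
        · simpa [hπ] using hc π hπ
      · simp only [if_true]
        intro e; rw [e] at hb; exact hmiss hb
    by_cases hβ : ∃ p, E π₀.1 p (c (nx π₀))
    · obtain ⟨a, ha⟩ := hβ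
      obtain ⟨π₁, hπ₁⟩ := nx_surj π₀
      refine htr (fun π => if π = π₀ then a else c π, fun π => c (nx π)) π₁ ⟨?_, ?_, ?_⟩
      · intro π hπ
        have : nx π ≠ π₀ := by rw [← hπ₁]; exact fun h => hπ (nx_inj h)
        simp [this]
      · intro π
        by_cases hπ : π = π₀
        · subst hπ; simpa using ha
        · simpa [hπ] using hc π hπ
      · simp only [hπ₁, if_true]
        intro e; rw [← e] at ha; exact hmiss ha
    push Not at hα hβ
    obtain ⟨E', hE', a1, a2, a3, a4⟩ := add_edge hI hC hG hCC hc hα hβ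
    refine ih (missing E') ?_ E' rfl a1 a2 a3 a4
    rw [← hm]
    unfold missing
    let f : {e : Fin k × V × V // ¬ E' e.1 e.2.1 e.2.2} → {e : Fin k × V × V // ¬ E e.1 e.2.1 e.2.2} :=
      fun e => ⟨e.1, fun h => e.2 ((hE' _ _ _).2 (Or.inl h))⟩
    have := Fintype.ofFinite {e : Fin k × V × V // ¬ E' e.1 e.2.1 e.2.2}
    have := Fintype.ofFinite {e : Fin k × V × V // ¬ E e.1 e.2.1 e.2.2}
    rw [Nat.card_eq_fintype_card, Nat.card_eq_fintype_card]
    refine Fintype.card_lt_of_injective_of_notMem f ?_ (b := ⟨(π₀.1, c π₀, c (nx π₀)), hmiss⟩) ?_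
    · intro x y h
      apply Subtype.ext
      exact congrArg (fun z => z.1) h
    · rintro ⟨⟨e, he⟩, h⟩
      have : e = (π₀.1, c π₀, c (nx π₀)) := congrArg (fun z => z.1) h
      subst this
      exact he ((hE' _ _ _).2 (Or.inr ⟨rfl, rfl, rfl⟩))

theorem outer {qq : FreeGroup (Fin k) →* G} (hqq : ∀ j, qq (rho k j) = 1)
    (hbase : ∀ (j : Fin k) (x : FreeGroup (Fin k)), qq x = qq (of j) →
      x ∉ Subgroup.closure (of '' {i | i ≠ j}))
    {φ : FreeGroup (Fin n) →* G} (hφ : ∀ j, ∃ y, φ y = qq (of j)) (m : ℕ) :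
    ∀ (V : Type) (_ : Finite V) (E : Fin k → V → V → Prop) (v₀ : V), Nat.card V = m →
      Imm E → Conn E v₀ → VGood qq φ E v₀ → CC E → Concl qq φ := by
  induction m using Nat.strong_induction_on with
  | _ m ih =>
  intro V _ E v₀ hm hI hC hG hCC
  by_cases h1 : 1 < Nat.card V
  · exact inner hqq v₀ h1 (fun W hW EW w₀ hlt => ih _ (hm ▸ hlt) W hW EW w₀ rfl) _ E rfl hI hC
      hG.good hCC
  · have : Subsingleton V := Finite.card_le_one_iff_subsingleton.1 (by omega)
    obtain ⟨ψ, hψ1, hψ2, hψ3⟩ := hG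
    refine ⟨ψ, hψ1, ?_⟩
    have hall : ∀ j, E j v₀ v₀ := by
      intro j
      by_contra hj
      obtain ⟨y, hy⟩ := hφ j
      refine hbase j (ψ y) ((hψ1 y).trans hy) ?_
      have : ∀ p g q, PP E xl p g q → g ∈ Subgroup.closure (of '' {i | i ≠ j}) := by
        have hne : ∀ i p q, E i p q → of i ∈ Subgroup.closure (of '' {i | i ≠ j}) := by
          intro i p q he
          refine Subgroup.subset_closure ⟨i, ?_, rfl⟩
          intro e
          rw [e, Subsingleton.elim p v₀, Subsingleton.elim q v₀] at he
          exact hj he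
        intro p g q hp
        induction hp with
        | nil => exact Subgroup.one_mem _
        | fwd _ he ih => exact Subgroup.mul_mem _ ih (hne _ _ _ he)
        | bwd _ he ih => exact Subgroup.mul_mem _ ih (Subgroup.inv_mem _ (hne _ _ _ he))
      exact this _ _ _ (hψ2 y)
    intro x
    change x ∈ ψ.range
    induction x using FreeGroup.induction_on with
    | C1 => exact Subgroup.one_mem _
    | of x => exact hψ3 _ (PP.edge (l := xl) (hall x))
    | inv_of x h => exact Subgroup.inv_mem _ h
    | mul x y hx hy => exact Subgroup.mul_mem _ hx hy

end Main
end NSurf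

namespace NSurf
open FreeGroup hiding map_mul map_inv map_one IsReduced

section Initial
variable {k n : ℕ} {G : Type} [Group G]

/-- ball in the free group -/
def Ball (k R : ℕ) : Set (FreeGroup (Fin k)) :=
  {g | ∃ L : List (Fin k × Bool), L.length ≤ R ∧ FreeGroup.mk L = g}

lemma Ball_finite (k R : ℕ) : (Ball k R).Finite := by
  refine ((List.finite_length_le (Fin k × Bool) R).image FreeGroup.mk).subset ?_
  rintro g ⟨L, h, e⟩
  exact ⟨L, h, e⟩

instance (k R : ℕ) : Finite (Ball k R) := (Ball_finite k R).to_subtype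

lemma Ball_mono {R R' : ℕ} (h : R ≤ R') {g : FreeGroup (Fin k)} (hg : g ∈ Ball k R) :
    g ∈ Ball k R' := by
  obtain ⟨L, h1, h2⟩ := hg
  exact ⟨L, h1.trans h, h2⟩

lemma Ball_mul_of {R : ℕ} {g : FreeGroup (Fin k)} (hg : g ∈ Ball k R) (i : Fin k) :
    g * of i ∈ Ball k (R + 1) := by
  obtain ⟨L, h1, rfl⟩ := hg
  exact ⟨L ++ [(i, true)], by simpa using h1, by rw [← FreeGroup.mul_mk]; rfl⟩

lemma exists_Ball (g : FreeGroup (Fin k)) : ∃ R, g ∈ Ball k R :=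
  ⟨g.toWord.length, g.toWord, le_rfl, FreeGroup.mk_toWord⟩

lemma one_mem_Ball (R : ℕ) : (1 : FreeGroup (Fin k)) ∈ Ball k R := ⟨[], by simp, rfl⟩

lemma normal_bound {r x : FreeGroup (Fin k)} (hx : x ∈ Subgroup.normalClosure {r}) :
    ∃ m, ∀ S : Subgroup (FreeGroup (Fin k)), (∀ h ∈ Ball k m, h * r * h⁻¹ ∈ S) → x ∈ S := by
  unfold Subgroup.normalClosure at hx
  induction hx using Subgroup.closure_induction with
  | mem x hx =>
    rw [Group.mem_conjugatesOfSet_iff] at hx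
    obtain ⟨a, ha, hc⟩ := hx
    rw [Set.mem_singleton_iff] at ha
    subst ha
    obtain ⟨h, rfl⟩ := isConj_iff.1 hc
    obtain ⟨m, hm⟩ := exists_Ball h
    exact ⟨m, fun S hS => hS h hm⟩
  | one => exact ⟨0, fun S _ => S.one_mem⟩
  | mul x y _ _ hx hy =>
    obtain ⟨a, ha⟩ := hx
    obtain ⟨b, hb⟩ := hy
    exact ⟨max a b, fun S hS => S.mul_mem (ha S fun h hh => hS h (Ball_mono (le_max_left _ _) hh))
      (hb S fun h hh => hS h (Ball_mono (le_max_right _ _) hh))⟩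
  | inv x _ hx =>
    obtain ⟨a, ha⟩ := hx
    exact ⟨a, fun S hS => S.inv_mem (ha S hS)⟩

lemma PP_act {Z : Type} {E : Fin k → Z → Z → Prop} {s : Fin k → Equiv.Perm Z}
    (hs : ∀ i p q, E i p q → s i p = q) {p q : Z} {g : FreeGroup (Fin k)} (h : PP E xl p g q) :
    FreeGroup.lift (fun i => (s i)⁻¹) g q = p := by
  induction h with
  | nil => simp
  | @fwd q s' g i _ he ih =>
    rw [map_mul, Equiv.Perm.mul_apply]
    simp only [xl, FreeGroup.lift_apply_of]
    rw [Equiv.Perm.inv_eq_iff_eq.2 (hs _ _ _ he).symm]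
    exact ih
  | @bwd q s' g i _ he ih =>
    rw [map_mul, Equiv.Perm.mul_apply]
    simp only [xl, map_inv, FreeGroup.lift_apply_of, inv_inv]
    rw [hs _ _ _ he]
    exact ih

/-- coset equivalence on the ball -/
def cosetS (H : Subgroup (FreeGroup (Fin k))) (R : ℕ) : Setoid (Ball k R) where
  r g g' := (g : FreeGroup (Fin k)) * (g' : FreeGroup (Fin k))⁻¹ ∈ H
  iseqv :=
    ⟨fun g => by simp [H.one_mem],
      fun {g g'} h => by simpa using H.inv_mem h,
      fun {g g' g''} h h' => by simpa [mul_assoc] using H.mul_mem h h'⟩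

/-- ball in the coset graph -/
def CV (H : Subgroup (FreeGroup (Fin k))) (R : ℕ) : Type := Quotient (cosetS H R)

instance (H : Subgroup (FreeGroup (Fin k))) (R : ℕ) : Finite (CV H R) :=
  inferInstanceAs (Finite (Quotient _))

/-- class of an element of the ball -/
def cm (H : Subgroup (FreeGroup (Fin k))) {R : ℕ} (g : Ball k R) : CV H R :=
  Quotient.mk (cosetS H R) g

lemma cm_eq {H : Subgroup (FreeGroup (Fin k))} {R : ℕ} {g g' : Ball k R} :
    cm H g = cm H g' ↔ (g : FreeGroup (Fin k)) * (g' : FreeGroup (Fin k))⁻¹ ∈ H :=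
  Quotient.eq (r := cosetS H R)

lemma cm_surj (H : Subgroup (FreeGroup (Fin k))) {R : ℕ} (a : CV H R) : ∃ g, cm H g = a :=
  Quotient.mk_surjective a

/-- edges of the coset graph -/
def CE (H : Subgroup (FreeGroup (Fin k))) (R : ℕ) (i : Fin k) (a b : CV H R) : Prop :=
  ∃ g g' : Ball k R, (g' : FreeGroup (Fin k)) = g * of i ∧ cm H g = a ∧ cm H g' = b

lemma CE_imm (H : Subgroup (FreeGroup (Fin k))) (R : ℕ) : Imm (CE H R) := by
  constructor
  · rintro i p q q' ⟨g, g', e, rfl, rfl⟩ ⟨h, h', e', e2, rfl⟩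
    rw [cm_eq] at e2 ⊢
    rw [e, e']
    simpa using H.inv_mem e2
  · rintro i p p' q ⟨g, g', e, rfl, rfl⟩ ⟨h, h', e', rfl, e2⟩
    rw [cm_eq] at e2 ⊢
    rw [e, e'] at e2
    simpa using H.inv_mem e2

/-- base point -/
def cb (H : Subgroup (FreeGroup (Fin k))) (R : ℕ) : CV H R := cm H ⟨1, one_mem_Ball R⟩

lemma CE_path_mem {H : Subgroup (FreeGroup (Fin k))} {R : ℕ} {a p : CV H R}
    {g : FreeGroup (Fin k)} (hp : PP (CE H R) xl a g p) (ha : a = cb H R) :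
    ∀ b : Ball k R, cm H b = p → g * (b : FreeGroup (Fin k))⁻¹ ∈ H := by
  induction hp with
  | nil =>
    intro b hb
    rw [ha] at hb
    have := cm_eq.1 hb.symm
    exact this
  | @fwd q s g i _ he ih =>
    intro b hb
    obtain ⟨g1, g2, e, e1, e2⟩ := he
    have h1 := ih g1 e1
    have h2 := cm_eq.1 (e2.trans hb.symm)
    rw [e] at h2
    have := H.mul_mem h1 h2
    simpa [xl, mul_assoc] using this
  | @bwd q s g i _ he ih =>
    intro b hb
    obtain ⟨g1, g2, e, e1, e2⟩ := he
    have h1 := ih g2 e2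
    have h2 := cm_eq.1 (e1.trans hb.symm)
    rw [e] at h1
    have := H.mul_mem h1 h2
    simpa [xl, mul_assoc] using this

lemma CE_path (H : Subgroup (FreeGroup (Fin k))) (R : ℕ) (L : List (Fin k × Bool)) :
    ∀ hL : FreeGroup.mk L ∈ Ball k R, L.length ≤ R →
      PP (CE H R) xl (cb H R) (FreeGroup.mk L) (cm H ⟨FreeGroup.mk L, hL⟩) := by
  induction L using List.reverseRecOn with
  | nil => intro _ _; exact PP.nil _
  | append_singleton L x ih =>
    intro hL hlen
    rw [List.length_append, List.length_singleton] at hlen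
    have hL' : FreeGroup.mk L ∈ Ball k R := ⟨L, by omega, rfl⟩
    have h0 := ih hL' (by omega)
    obtain ⟨i, b⟩ := x
    cases b
    · have e : FreeGroup.mk (L ++ [(i, false)]) = FreeGroup.mk L * (of i)⁻¹ := by
        rw [← FreeGroup.mul_mk]; rfl
      have hE : CE H R i (cm H ⟨FreeGroup.mk (L ++ [(i, false)]), hL⟩)
          (cm H ⟨FreeGroup.mk L, hL'⟩) := ⟨_, _, by simp [e], rfl, rfl⟩
      have := h0.bwd hE
      have e3 : FreeGroup.mk L * (xl i (cm H ⟨FreeGroup.mk (L ++ [(i, false)]), hL⟩)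
          (cm H ⟨FreeGroup.mk L, hL'⟩))⁻¹ = FreeGroup.mk (L ++ [(i, false)]) := e.symm
      rw [e3] at this
      exact this
    · have e : FreeGroup.mk (L ++ [(i, true)]) = FreeGroup.mk L * of i := by
        rw [← FreeGroup.mul_mk]; rfl
      have hE : CE H R i (cm H ⟨FreeGroup.mk L, hL'⟩)
          (cm H ⟨FreeGroup.mk (L ++ [(i, true)]), hL⟩) := ⟨_, _, by simp [e], rfl, rfl⟩
      have := h0.fwd hE
      have e3 : FreeGroup.mk L * (xl i (cm H ⟨FreeGroup.mk L, hL'⟩)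
          (cm H ⟨FreeGroup.mk (L ++ [(i, true)]), hL⟩)) = FreeGroup.mk (L ++ [(i, true)]) := e.symm
      rw [e3] at this
      exact this

lemma CE_path' (H : Subgroup (FreeGroup (Fin k))) {R : ℕ} (b : Ball k R) :
    PP (CE H R) xl (cb H R) (b : FreeGroup (Fin k)) (cm H b) := by
  obtain ⟨g, hg⟩ := b
  obtain ⟨L, h1, rfl⟩ := id hg
  exact CE_path H R L hg h1

lemma CE_conn (H : Subgroup (FreeGroup (Fin k))) (R : ℕ) : Conn (CE H R) (cb H R) := by
  intro p
  obtain ⟨b, rfl⟩ := cm_surj H p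
  exact ⟨_, CE_path' H b⟩

variable [NeZero k]

lemma exists_idx (π : Fin k × Bool) : ∃ t < 2 * k, sg t = π := by
  have hk : 0 < 2 * k := by have := NeZero.pos k; omega
  obtain ⟨j, hj⟩ := sg_surj π
  have key : ∀ t m : ℕ, (sg (m + t * (2 * k)) : Fin k × Bool) = sg m := by
    intro t m
    induction t with
    | zero => simp
    | succ t ih => rw [add_mul, one_mul, ← add_assoc, sg_period, ih]
  refine ⟨j % (2 * k), Nat.mod_lt _ hk, ?_⟩
  rw [← hj]
  conv_rhs => rw [← Nat.mod_add_div' j (2 * k)]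
  rw [key]

/-- index of a position -/
noncomputable def idx (π : Fin k × Bool) : ℕ := (exists_idx π).choose

lemma idx_lt (π : Fin k × Bool) : idx π < 2 * k := (exists_idx π).choose_spec.1
lemma sg_idx (π : Fin k × Bool) : sg (idx π) = π := (exists_idx π).choose_spec.2

lemma sg_inj {s t : ℕ} (hs : s < 2 * k) (ht : t < 2 * k) (h : (sg s : Fin k × Bool) = sg t) :
    s = t := by
  rcases lt_trichotomy s t with h1 | h1 | h1
  · exfalso
    have := sg_ne (k := k) (j := s) (m := t - s) (by omega) (by omega)
    rw [show s + (t - s) = t by omega] at this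
    exact this h.symm
  · exact h1
  · exfalso
    have := sg_ne (k := k) (j := t) (m := s - t) (by omega) (by omega)
    rw [show t + (s - t) = s by omega] at this
    exact this h

lemma idx_sg {t : ℕ} (ht : t < 2 * k) : idx (sg t : Fin k × Bool) = t :=
  sg_inj (idx_lt _) ht (sg_idx _)

/-- relator cycle in an RC graph -/
lemma RC_cycle {H : Subgroup (FreeGroup (Fin k))} {R m : ℕ} (hR : m + 2 * k ≤ R)
    {h : FreeGroup (Fin k)} (hh : h ∈ Ball k m)
    {Z : Type} {EZ : Fin k → Z → Z → Prop} (hRZ : RC EZ) {f : CV H R → Z}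
    (hf : ∀ i p q, CE H R i p q → EZ i (f p) (f q)) (hh' : h ∈ Ball k R) :
    PP EZ xl (f (cm H ⟨h, hh'⟩)) (rho k 0) (f (cm H ⟨h, hh'⟩)) := by
  have hk := NeZero.pos k
  let a : ℕ → FreeGroup (Fin k) := fun m => of (sg m : Fin k × Bool).1
  have hb0 : ∀ t, h * pr a 0 t ∈ Ball k (m + t) := by
    intro t
    induction t with
    | zero => simpa [pr] using hh
    | succ t ih => rw [pr, ← mul_assoc, ← add_assoc]; exact Ball_mul_of ih _
  have hb : ∀ t, t < 2 * k → h * pr a 0 t ∈ Ball k R :=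
    fun t ht => Ball_mono (by omega) (hb0 t)
  let c : Fin k × Bool → Z := fun π => f (cm H ⟨_, hb (idx π) (idx_lt π)⟩)
  have hc : ∀ t (ht : t < 2 * k), c (sg t) = f (cm H ⟨_, hb t ht⟩) := by
    intro t ht
    simp only [c, idx_sg ht]
  have hc0 : c (sg 0) = f (cm H ⟨h, hh'⟩) := by
    rw [hc 0 (by omega)]
    simp [pr]
  have hedge : ∀ π, π ≠ sg (2 * k - 1) → EZ π.1 (c π) (c (nx π)) := by
    intro π hπ
    obtain ⟨t, ht, rfl⟩ := exists_idx π
    have ht' : t + 1 < 2 * k := by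
      by_contra hcon
      apply hπ
      congr 1; omega
    rw [← sg_succ, hc t ht, hc (t + 1) ht']
    apply hf
    refine ⟨_, _, ?_, rfl, rfl⟩
    simp [pr, a, mul_assoc]
  have hlast := hRZ c _ hedge
  have hall : ∀ π : Fin k × Bool, EZ π.1 (c π) (c (nx π)) := by
    intro π
    by_cases h : π = sg (2 * k - 1)
    · rw [h]; exact hlast
    · exact hedge π h
  have := PP_pr (E := EZ) (l := xl) (fun t => c (sg t)) a 0 (2 * k) (by
    intro t _
    rw [sg_succ]
    exact PP.edge (l := xl) (hall (sg (0 + t))))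
  rw [sg_period, hc0] at this
  exact this

theorem concl {qq : FreeGroup (Fin k) →* G} (hsurj : Function.Surjective qq)
    (hker : qq.ker = Subgroup.normalClosure {rho k 0}) (hqq : ∀ j, qq (rho k j) = 1)
    (hbase : ∀ (j : Fin k) (x : FreeGroup (Fin k)), qq x = qq (of j) →
      x ∉ Subgroup.closure (of '' {i | i ≠ j}))
    {φ : FreeGroup (Fin n) →* G} (hφ : Function.Surjective φ) : Concl qq φ := by
  choose lf hlf using fun i => hsurj (φ (of i))
  let ψ : FreeGroup (Fin n) →* FreeGroup (Fin k) := FreeGroup.lift lf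
  have hψ : ∀ y, qq (ψ y) = φ y := by
    intro y
    have : qq.comp ψ = φ := by ext i; simp [ψ, hlf]
    rw [← this]; rfl
  have hx : ∀ j, ∃ y, ∃ m, ∀ S : Subgroup (FreeGroup (Fin k)),
      (∀ h ∈ Ball k m, h * rho k 0 * h⁻¹ ∈ S) → (ψ y)⁻¹ * of j ∈ S := by
    intro j
    obtain ⟨y, hy⟩ := hφ (qq (of j))
    refine ⟨y, normal_bound ?_⟩
    rw [← hker, MonoidHom.mem_ker, map_mul, map_inv, hψ, hy, inv_mul_cancel]
  choose y m hm using hx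
  choose lb hlb using fun i : Fin n => exists_Ball (ψ (of i))
  let M := Finset.univ.sup m
  let R := M + 2 * k + Finset.univ.sup lb
  let H := ψ.range
  refine outer hqq hbase (fun j => hφ _) _ (CV H R) inferInstance (CE H R) (cb H R) rfl
    (CE_imm H R) (CE_conn H R) ?_ ?_
  · refine ⟨ψ, hψ, ?_, ?_⟩
    · intro y
      induction y using FreeGroup.induction_on with
      | C1 => rw [map_one]; exact PP.nil _
      | of i =>
        have hi : ψ (of i) ∈ Ball k R :=
          Ball_mono (le_trans (Finset.le_sup (Finset.mem_univ i)) (Nat.le_add_left _ _)) (hlb i)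
        have h1 := CE_path' H ⟨_, hi⟩
        have h2 : cm H ⟨ψ (of i), hi⟩ = cb H R := by
          rw [cb, cm_eq]
          simp [H]
        rw [h2] at h1
        exact h1
      | inv_of x h => rw [map_inv]; exact h.symm
      | mul x y hx hy => rw [map_mul]; exact hx.trans hy
    · intro g hg
      have h1 := CE_path_mem hg rfl _ rfl
      have h2 : g ∈ H := by simpa using h1
      exact h2
  · intro Z hZ EZ hIZ hRZ f hf
    obtain ⟨s, hs⟩ := exists_perm hIZ
    let T : FreeGroup (Fin k) →* Equiv.Perm Z := FreeGroup.lift (fun i => (s i)⁻¹)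
    have hT : ∀ {p q g}, PP EZ xl p g q → T g q = p := fun h => PP_act hs h
    have hfp : ∀ {p q g}, PP (CE H R) xl p g q → PP EZ xl (f p) g (f q) := fun h =>
      PP.bind (l' := xl) f (MonoidHom.id _) (fun i p q he => PP.edge (l := xl) (hf i p q he)) h
    let z := f (cb H R)
    let S : Subgroup (FreeGroup (Fin k)) := (MulAction.stabilizer (Equiv.Perm Z) z).comap T
    have hS : ∀ g, g ∈ S ↔ T g z = z := fun g => Iff.rfl
    have hpS : ∀ g, PP EZ xl z g z → g ∈ S := fun g hg => (hS g).2 (hT hg)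
    have hrS : ∀ h ∈ Ball k M, h * rho k 0 * h⁻¹ ∈ S := by
      intro h hh
      have hh' : h ∈ Ball k R := Ball_mono (by simp only [R]; omega) hh
      have h1 := hfp (CE_path' H ⟨h, hh'⟩)
      have h2 := RC_cycle (H := H) (R := R) (m := M) (by simp only [R]; omega) hh hRZ hf hh'
      exact hpS _ ((h1.trans h2).trans h1.symm)
    have hψS : ∀ y, ψ y ∈ S := by
      intro y
      induction y using FreeGroup.induction_on with
      | C1 => rw [map_one]; exact S.one_mem
      | of i =>
        have hi : ψ (of i) ∈ Ball k R :=
          Ball_mono (le_trans (Finset.le_sup (Finset.mem_univ i)) (Nat.le_add_left _ _)) (hlb i)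
        have h1 := CE_path' H ⟨_, hi⟩
        have h2 : cm H ⟨ψ (of i), hi⟩ = cb H R := by
          rw [cb, cm_eq]
          simp [H]
        rw [h2] at h1
        exact hpS _ (hfp h1)
      | inv_of x h => rw [map_inv]; exact S.inv_mem h
      | mul x y hx hy => rw [map_mul]; exact S.mul_mem hx hy
    have hof : ∀ j, of j ∈ S := by
      intro j
      have h1 := hm j S fun h hh => hrS h (Ball_mono (Finset.le_sup (Finset.mem_univ j)) hh)
      have := S.mul_mem (hψS (y j)) h1
      simpa using this
    have hall : ∀ g, g ∈ S := by
      intro g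
      induction g using FreeGroup.induction_on with
      | C1 => exact S.one_mem
      | of i => exact hof i
      | inv_of x h => exact S.inv_mem h
      | mul x y hx hy => exact S.mul_mem hx hy
    have hconst : ∀ p, f p = z := by
      intro p
      obtain ⟨g, hg⟩ := CE_conn H R p
      have h1 := hT (hfp hg)
      have h2 := (hS g).1 (hall g)
      exact (T g).injective (h1.trans h2.symm)
    intro p q
    rw [hconst, hconst]

end Initial
end NSurf


theorem irreducible_epi_to_nonorientable_surface_group_rank_eq (k n : ℕ) (hk : 1 ≤ k)
    (φ : FreeGroup (Fin n) →* NonorientableSurfaceGroup k) (hφ : Function.Surjective φ)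
    (hirr : ∀ (α : FreeGroup (Fin n) ≃* FreeGroup (Fin n)) (i : Fin n),
      (φ.comp α.toMonoidHom) (FreeGroup.of i) ≠ 1) :
    n = k := by
  have : NeZero k := ⟨by omega⟩
  have hrel : NSurf.rho k 0 = nonorientableRelator k := NSurf.rho_zero_eq
  have hker : (standardRho k).ker = Subgroup.normalClosure {NSurf.rho k 0} := by
    rw [hrel]
    exact QuotientGroup.ker_mk' _
  have hqq0 : standardRho k (NSurf.rho k 0) = 1 := by
    rw [← MonoidHom.mem_ker, hker]
    exact Subgroup.subset_normalClosure rfl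
  have hqq : ∀ j, standardRho k (NSurf.rho k j) = 1 := by
    intro j
    unfold NSurf.rho at hqq0 ⊢
    rw [NSurf.pr_map] at hqq0 ⊢
    refine NSurf.pr_rot_all ?_ hqq0 j
    intro t
    simp only [NSurf.sg_period]
  have hbase : ∀ (j : Fin k) (x : FreeGroup (Fin k)), standardRho k x = standardRho k (FreeGroup.of j) →
      x ∉ Subgroup.closure (FreeGroup.of '' {i | i ≠ j}) := by
    intro j x hx hmem
    let θ : FreeGroup (Fin k) →* Multiplicative (ZMod 2) :=
      FreeGroup.lift (fun i => if i = j then Multiplicative.ofAdd 1 else 1)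
    have hsq : ∀ z : Multiplicative (ZMod 2), z ^ 2 = 1 := by decide
    have hle : (standardRho k).ker ≤ θ.ker := by
      rw [hker]
      apply Subgroup.normalClosure_le_normal
      rw [Set.singleton_subset_iff, SetLike.mem_coe, MonoidHom.mem_ker, hrel, nonorientableRelator,
        map_list_prod, List.map_map]
      apply List.prod_eq_one
      intro z hz
      rw [List.mem_map] at hz
      obtain ⟨i, _, rfl⟩ := hz
      simp only [Function.comp_apply, map_pow, hsq]
    have h1 : x⁻¹ * FreeGroup.of j ∈ (standardRho k).ker := by
      rw [MonoidHom.mem_ker, map_mul, map_inv, hx, inv_mul_cancel]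
    have h2 := hle h1
    have h3 : Subgroup.closure (FreeGroup.of '' {i | i ≠ j}) ≤ θ.ker := by
      rw [Subgroup.closure_le]
      rintro _ ⟨i, hi, rfl⟩
      have hi' : i ≠ j := hi
      rw [SetLike.mem_coe, MonoidHom.mem_ker]
      simp [θ, hi']
    have h4 := θ.ker.mul_mem (h3 hmem) h2
    rw [mul_inv_cancel_left, MonoidHom.mem_ker] at h4
    simp only [θ, FreeGroup.lift_apply_of, if_true] at h4
    revert h4
    decide
  obtain ⟨ψ, hψ, hs⟩ := NSurf.concl (qq := standardRho k) (QuotientGroup.mk'_surjective _) hker hqq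
    hbase hφ
  have hinj : Function.Injective ψ := by
    apply NSurf.nielsen
    intro α i h
    apply hirr α i
    change φ (α (FreeGroup.of i)) = 1
    rw [← hψ, h, map_one]
  have e := Equiv.ofFreeGroupEquiv (MulEquiv.ofBijective ψ ⟨hinj, hs⟩)
  simpa using Fintype.card_congr e
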